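/- arXiv:2404.09594 — 3 statements merged into one kernel-verified Lean document; each statement's English description precedes it below -/
import Mathlib

section
/- Let m ≥ 8 be an integer such that m ≡ 0 (mod 4) and m−1 ∈ 𝓜. Then there exists N (depending only on m) such that for all n ≥ N and every polynomial f(x) = a₀x^m + a₁x^{m−1} + a₂x^{m−2} ∈ 𝔽_{2ⁿ}[x] of degree m with a₁ ≠ 0, there exist α ∈ 𝔽_{2ⁿ}\{0} and β ∈ 𝔽_{2ⁿ} such that the equation f(x+α) − f(x) = β has exactly m−2 distinct solutions x ∈ 𝔽_{2ⁿ}. -/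
open Polynomial

/-- Membership in the set `𝓜` of odd positive integers `m` such that for all `ζ₁, ζ₂` in the
algebraic closure of `𝔽₂` with `ζ₁ ≠ 1` and `ζ₂ ≠ 1`, the conditions
`ζ₁ ^ (m-1) = ζ₂ ^ (m-1) = ((1+ζ₁)/(1+ζ₂)) ^ (m-1) = 1` imply `ζ₁ = ζ₂` or `ζ₁ = ζ₂⁻¹`. -/
def InM (m : ℕ) : Prop :=
  Odd m ∧ 0 < m ∧
    ∀ ζ₁ ζ₂ : AlgebraicClosure (ZMod 2), ζ₁ ≠ 1 → ζ₂ ≠ 1 →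
      ζ₁ ^ (m - 1) = 1 → ζ₂ ^ (m - 1) = 1 →
      ((1 + ζ₁) / (1 + ζ₂)) ^ (m - 1) = 1 →
      ζ₁ = ζ₂ ∨ ζ₁ = ζ₂⁻¹

section Stepanov

variable {k S ι : Type*} [Field k] [CommRing S] [IsDomain S] [Algebra k S] [Fintype ι]

/-- A filtration of an algebra over a field by finite-dimensional subspaces whose dimension grows like
`D * e`, where `D` is the number of elements of a family `b` which, together with its multiples by
powers of `T`, realizes that growth. -/
structure LinearFiltration (k : Type*) {S ι : Type*} [Field k] [CommRing S] [Algebra k S]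
    [Fintype ι] (b : ι → S) (T : S) (C : ℕ) where
  V : ℕ → Submodule k S
  mono : Monotone V
  mul_mem : ∀ {i j x y}, x ∈ V i → y ∈ V j → x * y ∈ V (i + j)
  one_mem : 1 ∈ V 0
  exists_mem : ∀ x, ∃ e, x ∈ V e
  finite : ∀ e, FiniteDimensional k (V e)
  finrank_le : ∀ e, Module.finrank k (V e) ≤ Fintype.card ι * (e + 1)
  gen_mem : T ∈ V 1
  base_mem : ∀ i, b i ∈ V C
  linearIndependent : LinearIndependent k (fun x : ι × ℕ => b x.1 * T ^ x.2)

namespace LinearFiltration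

variable {b : ι → S} {T : S} {C : ℕ} (𝓕 : LinearFiltration k b T C)
include 𝓕

set_option linter.unusedSectionVars false

theorem pow_mem {e : ℕ} {x : S} (hx : x ∈ 𝓕.V e) (n : ℕ) : x ^ n ∈ 𝓕.V (e * n) := by
  induction n with
  | zero => simpa using 𝓕.one_mem
  | succ n ih => rw [pow_succ, Nat.mul_succ]; exact 𝓕.mul_mem ih hx

theorem base_mul_pow_mem (i : ι) (j : ℕ) : b i * T ^ j ∈ 𝓕.V (j + C) := by
  rw [add_comm]
  refine 𝓕.mul_mem (𝓕.base_mem i) ?_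
  simpa using 𝓕.pow_mem 𝓕.gen_mem j

theorem le_finrank (e : ℕ) : Fintype.card ι * (e + 1) ≤ Module.finrank k (𝓕.V (e + C)) := by
  have := 𝓕.finite (e + C)
  have hmem : ∀ x : ι × Fin (e + 1), b x.1 * T ^ (x.2 : ℕ) ∈ 𝓕.V (e + C) := fun x =>
    𝓕.mono (by have := x.2.2; omega) (𝓕.base_mul_pow_mem x.1 x.2)
  have hli : LinearIndependent k
      (fun x : ι × Fin (e + 1) => (⟨b x.1 * T ^ (x.2 : ℕ), hmem x⟩ : 𝓕.V (e + C))) := by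
    refine LinearIndependent.of_comp (𝓕.V (e + C)).subtype ?_
    refine 𝓕.linearIndependent.comp (fun x : ι × Fin (e + 1) => (x.1, (x.2 : ℕ))) ?_
    rintro ⟨x, i⟩ ⟨y, j⟩ h
    simp only [Prod.mk.injEq] at h
    exact Prod.ext h.1 (Fin.ext h.2)
  simpa using hli.fintype_card_le_finrank

/-- Elements that are independent modulo the multiples of a nonzero element of small degree are
few. -/
theorem card_le_of_independent_mod {l : ℕ} {x : S} (hx : x ∈ 𝓕.V l) (hx0 : x ≠ 0) {N : ℕ}
    (y : Fin N → S) (hy : ∀ (c : Fin N → k) (z : S), ∑ i, c i • y i = x * z → c = 0) :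
    N ≤ Fintype.card ι * (l + C) := by
  choose e he using fun i => 𝓕.exists_mem (y i)
  set a := ∑ i, e i
  have hya : ∀ i, y i ∈ 𝓕.V (a + l + C) := fun i =>
    𝓕.mono (by have := Finset.single_le_sum (f := e) (fun i _ => Nat.zero_le _)
                (Finset.mem_univ i); omega) (he i)
  have := 𝓕.finite (a + l + C)
  have := 𝓕.finite (a + C)
  let f : (Fin N → k) × 𝓕.V (a + C) →ₗ[k] S :=
    (Fintype.linearCombination k y).coprod ((LinearMap.mulLeft k x).comp (𝓕.V (a + C)).subtype)
  have hf : ∀ p, f p ∈ 𝓕.V (a + l + C) := by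
    rintro ⟨c, z⟩
    simp only [f, LinearMap.coprod_apply, Fintype.linearCombination_apply, LinearMap.comp_apply,
      LinearMap.mulLeft_apply, Submodule.subtype_apply]
    refine add_mem (Submodule.sum_mem _ fun i _ => Submodule.smul_mem _ _ (hya i)) ?_
    have := 𝓕.mul_mem hx z.2
    rwa [show l + (a + C) = a + l + C by ring] at this
  have hinj : Function.Injective (f.codRestrict _ hf) := by
    rw [← LinearMap.ker_eq_bot, LinearMap.ker_codRestrict, LinearMap.ker_eq_bot']
    rintro ⟨c, z⟩ h
    simp only [f, LinearMap.coprod_apply, Fintype.linearCombination_apply, LinearMap.comp_apply,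
      LinearMap.mulLeft_apply, Submodule.subtype_apply] at h
    have hc : c = 0 := hy c (-z) (by linear_combination h)
    subst hc
    have hz : x * (z : S) = 0 := by simpa using h
    have : (z : S) = 0 := by simpa [hx0] using hz
    ext <;> simp [this]
  have h1 := LinearMap.finrank_le_finrank_of_injective hinj
  rw [Module.finrank_prod, Module.finrank_fin_fun] at h1
  have h2 := 𝓕.le_finrank a
  have h3 := 𝓕.finrank_le (a + l + C)
  nlinarith

/-- A nonzero function of degree `l` has at most `D * (l + C)` zeros. -/
theorem card_zeros_le {l : ℕ} {x : S} (hx : x ∈ 𝓕.V l) (hx0 : x ≠ 0)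
    (Φ : Finset (S →ₐ[k] k)) (hΦ : ∀ φ ∈ Φ, φ x = 0) : Φ.card ≤ Fintype.card ι * (l + C) := by
  classical
  have hsep : ∀ φ ψ : S →ₐ[k] k, ∃ z : S, φ ≠ ψ → ψ z = 0 ∧ φ z ≠ 0 := by
    intro φ ψ
    by_cases h : φ = ψ
    · exact ⟨0, fun h' => absurd h h'⟩
    · obtain ⟨z, hz⟩ : ∃ z, φ z ≠ ψ z := by
        by_contra! h'
        exact h (AlgHom.ext h')
      exact ⟨z - algebraMap k S (ψ z), fun _ => by simp [sub_ne_zero, hz]⟩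
  choose z hz using hsep
  let e := Φ.equivFin.symm
  let y : Fin Φ.card → S := fun i => ∏ ψ ∈ Φ.erase (e i), z (e i) ψ
  have hyd : ∀ i, (e i : S →ₐ[k] k) (y i) ≠ 0 := by
    intro i
    simp only [y, map_prod]
    refine Finset.prod_ne_zero_iff.2 fun ψ hψ => ?_
    exact (hz _ _ (Finset.ne_of_mem_erase hψ).symm).2
  have hyo : ∀ i j, i ≠ j → (e j : S →ₐ[k] k) (y i) = 0 := by
    intro i j hij
    simp only [y, map_prod]
    have hne : (e j : S →ₐ[k] k) ≠ e i := fun h => hij (e.injective (Subtype.ext h)).symm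
    refine Finset.prod_eq_zero (Finset.mem_erase.2 ⟨hne, (e j).2⟩) ?_
    exact (hz _ _ hne.symm).1
  refine 𝓕.card_le_of_independent_mod hx hx0 y fun c w h => ?_
  funext j
  have := congrArg (e j : S →ₐ[k] k) h
  rw [map_sum, map_mul, hΦ _ (e j).2, zero_mul,
    Finset.sum_eq_single j (fun i _ hij => by rw [map_smul, hyo i j hij, smul_zero])
      (by simp)] at this
  simpa [hyd j] using this

end LinearFiltration
end Stepanov

section Order

variable {k S ι : Type*} [Field k] [CommRing S] [Algebra k S]

/-- An order of vanishing at a rational point of a curve with coordinate ring `S`. -/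
structure IsPointOrder (k : Type*) {S : Type*} [Field k] [CommRing S] [Algebra k S]
    (v : AddValuation S ℕ∞) : Prop where
  eq_zero : ∀ x, v x = ⊤ → x = 0
  exists_lt : ∀ (x y : S) (n : ℕ), v x = n → v y = n → ∃ c : k, (n : ℕ∞) < v (x - c • y)
  exists_uniformizer : ∃ π : S, v π = 1

namespace IsPointOrder

variable {v : AddValuation S ℕ∞} (hv : IsPointOrder k v)

theorem map_algebraMap {v : AddValuation S ℕ∞} {c : k} (hc : c ≠ 0) :
    v (algebraMap k S c) = 0 := by
  have h : v (algebraMap k S c) + v (algebraMap k S c⁻¹) = 0 := by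
    rw [← v.map_mul, ← map_mul, mul_inv_cancel₀ hc, map_one, v.map_one]
  exact (add_eq_zero.1 h).1

theorem map_smul {v : AddValuation S ℕ∞} {c : k} (hc : c ≠ 0) (x : S) : v (c • x) = v x := by
  rw [Algebra.smul_def, v.map_mul, map_algebraMap hc, zero_add]

theorem map_sum_ne_top {v : AddValuation S ℕ∞} {α : Type*} (s : Finset α) (f : α → S)
    (hinj : ∀ i ∈ s, ∀ j ∈ s, v (f i) ≠ ⊤ → v (f i) = v (f j) → i = j)
    (hne : ∃ i ∈ s, v (f i) ≠ ⊤) : ∃ i ∈ s, v (∑ j ∈ s, f j) = v (f i) ∧ v (f i) ≠ ⊤ := by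
  classical
  obtain ⟨i₀, hi₀, hne⟩ := hne
  obtain ⟨i, hi, hmin⟩ := s.exists_min_image (fun j => v (f j)) ⟨i₀, hi₀⟩
  have hit : v (f i) ≠ ⊤ := fun h => hne (top_le_iff.1 (h ▸ hmin i₀ hi₀))
  refine ⟨i, hi, ?_, hit⟩
  rw [← Finset.add_sum_erase _ _ hi]
  have hlt : v (f i) < v (∑ j ∈ s.erase i, f j) := by
    refine v.map_lt_sum hit fun j hj => ?_
    refine lt_of_le_of_ne (hmin j (Finset.mem_of_mem_erase hj)) fun h => ?_
    exact Finset.ne_of_mem_erase hj (hinj i hi j (Finset.mem_of_mem_erase hj) hit h).symm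
  rw [add_comm]
  exact v.map_add_eq_of_lt_right hlt

include hv in
/-- A finite-dimensional space of functions has a family of as many elements as its dimension with
distinct orders of vanishing. -/
theorem exists_distinct_orders (W : Submodule k S) [FiniteDimensional k W] {B : ℕ}
    (hB : ∀ x ∈ W, x ≠ 0 → v x ≤ B) :
    ∃ (O : Finset ℕ) (ν : ℕ → S), Module.finrank k W ≤ O.card ∧
      ∀ n ∈ O, ν n ∈ W ∧ v (ν n) = n ∧ n ≤ B := by
  classical
  let O : Finset ℕ := (Finset.range (B + 1)).filter fun n : ℕ => ∃ x ∈ W, v x = (n : ℕ∞)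
  have hO : ∀ n : ℕ, ∃ x : S, n ∈ O → x ∈ W ∧ v x = n := by
    intro n
    by_cases hn : n ∈ O
    · obtain ⟨x, hx⟩ := (Finset.mem_filter.1 hn).2
      exact ⟨x, fun _ => hx⟩
    · exact ⟨0, fun h => absurd h hn⟩
  choose ν hν using hO
  refine ⟨O, ν, ?_, fun n hn => ⟨(hν n hn).1, (hν n hn).2, ?_⟩⟩
  · have key : ∀ j : ℕ, j ≤ B + 1 → ∀ x ∈ W, ((B + 1 - j : ℕ) : ℕ∞) ≤ v x →
        x ∈ Submodule.span k (ν '' O) := by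
      intro j
      induction j with
      | zero =>
        intro _ x hx hvx
        have : x = 0 := by
          by_contra h0
          have := hvx.trans (hB x hx h0)
          simp only [Nat.sub_zero, Nat.cast_le] at this
          omega
        rw [this]; exact zero_mem _
      | succ j ih =>
        intro hj x hx hvx
        rcases hvx.lt_or_eq with h | h
        · refine ih (by omega) x hx ?_
          have := Order.add_one_le_of_lt h
          have e : B + 1 - j = (B + 1 - (j + 1)) + 1 := by omega
          rw [e]; exact_mod_cast this
        · set n := B + 1 - (j + 1) with hn
          have hnO : n ∈ O := Finset.mem_filter.2
            ⟨Finset.mem_range.2 (by omega), x, hx, h.symm⟩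
          obtain ⟨c, hc⟩ := hv.exists_lt x (ν n) n h.symm (hν n hnO).2
          have h1 : x - c • ν n ∈ Submodule.span k (ν '' O) := by
            refine ih (by omega) _ (sub_mem hx (Submodule.smul_mem _ _ (hν n hnO).1)) ?_
            have := Order.add_one_le_of_lt hc
            have e : B + 1 - j = n + 1 := by omega
            rw [e]; exact_mod_cast this
          have h2 : c • ν n ∈ Submodule.span k (ν '' O) :=
            Submodule.smul_mem _ _ (Submodule.subset_span ⟨n, hnO, rfl⟩)
          simpa using add_mem h1 h2
    have hle : W ≤ Submodule.span k (O.image ν : Set S) := by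
      intro x hx
      rw [Finset.coe_image]
      exact key (B + 1) le_rfl x hx (by simp)
    have : FiniteDimensional k (Submodule.span k (O.image ν : Set S)) :=
      FiniteDimensional.span_finset k _
    calc Module.finrank k W ≤ _ := Submodule.finrank_mono hle
      _ ≤ (O.image ν).card := finrank_span_finset_le_card _
      _ ≤ O.card := Finset.card_image_le
  · have := (Finset.mem_filter.1 hn).1
    rw [Finset.mem_range] at this
    omega

end IsPointOrder

namespace LinearFiltration

variable [IsDomain S] [Fintype ι] {b : ι → S} {T : S} {C : ℕ} (𝓕 : LinearFiltration k b T C)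
  {v : AddValuation S ℕ∞} (hv : IsPointOrder k v)
include 𝓕 hv

theorem order_le {l : ℕ} {x : S} (hx : x ∈ 𝓕.V l) (hx0 : x ≠ 0) :
    v x ≤ (Fintype.card ι * (l + C) : ℕ) := by
  obtain ⟨π, hπ⟩ := hv.exists_uniformizer
  by_contra! hlt
  set N := Fintype.card ι * (l + C) with hN
  have : N + 1 ≤ N := by
    refine 𝓕.card_le_of_independent_mod hx hx0 (fun i : Fin (N + 1) => π ^ (i : ℕ))
      fun c z h => ?_
    by_contra hc
    obtain ⟨i₀, hi₀⟩ := Function.ne_iff.1 hc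
    have hval : ∀ i, c i ≠ 0 → v (c i • π ^ (i : ℕ)) = (i : ℕ) := by
      intro i hi
      rw [IsPointOrder.map_smul hi, v.map_pow, hπ]
      simp
    obtain ⟨i, -, hi, hit⟩ := IsPointOrder.map_sum_ne_top (v := v) Finset.univ
      (fun i : Fin (N + 1) => c i • π ^ (i : ℕ)) (by
        intro i _ j _ hi hij
        have hci : c i ≠ 0 := fun h => hi (by rw [h, zero_smul, v.map_zero])
        have hcj : c j ≠ 0 := fun h => hi (by rw [hij, h, zero_smul, v.map_zero])
        rw [hval i hci, hval j hcj] at hij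
        exact Fin.ext (by exact_mod_cast hij)) ⟨i₀, Finset.mem_univ _, by
          rw [hval i₀ hi₀]; exact ENat.natCast_ne_top _⟩
    have hci : c i ≠ 0 := fun h => hit (by rw [h, zero_smul, v.map_zero])
    rw [h, v.map_mul, hval i hci] at hi
    have h1 : v x ≤ (i : ℕ) := by rw [← hi]; exact le_self_add
    have h2 := hlt.trans_le h1
    have h3 : N < (i : ℕ) := by exact_mod_cast h2
    have := i.2
    omega
  omega

end LinearFiltration
end Order

namespace LinearFiltration

variable {k S ι : Type*} [Field k] [CommRing S] [Algebra k S] [IsDomain S] [Fintype ι]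
  {b : ι → S} {T : S} {C : ℕ} (𝓕 : LinearFiltration k b T C)
  {v : AddValuation S ℕ∞} (hv : IsPointOrder k v)
include 𝓕 hv

/-- Stepanov's method: the points on which the `q`-power Frobenius acts in a prescribed way are
not much more than `q` in number. -/
theorem card_frobenius_points_le [IsAlgClosed k] (p : ℕ) [Fact p.Prime] [CharP k p]
    (b' : ι → S) (hb' : ∀ i, b' i ∈ 𝓕.V C) {μ ν l m : ℕ}
    (hQ : Fintype.card ι * (l + C + C) < p ^ ν)
    (hdim : Fintype.card ι * ((l + C) * p ^ μ + m + C + 1) <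
      Fintype.card ι * (l + 1) * (Fintype.card ι * (m + 1)))
    (Φ : Finset (S →ₐ[k] k)) (hΦ : ∀ φ ∈ Φ, ∀ i, φ (b i) ^ (p ^ ν * p ^ μ) = φ (b' i))
    (hΦT : ∀ φ ∈ Φ, φ T ^ (p ^ ν * p ^ μ) = φ T) :
    Φ.card ≤ Fintype.card ι * (l + C + p ^ ν * (m + C) + C) := by
  classical
  have := charP_of_injective_algebraMap (algebraMap k S).injective p
  have := ExpChar.prime (R := S) (Fact.out : p.Prime)
  have hp : 0 < p := (Fact.out : p.Prime).pos
  have := 𝓕.finite (l + C)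
  have := 𝓕.finite ((l + C) * p ^ μ + (m + C))
  obtain ⟨O, w, hO, hw⟩ := hv.exists_distinct_orders (𝓕.V (l + C))
    (fun x hx hx0 => 𝓕.order_le hv hx hx0)
  have hOcard := (𝓕.le_finrank l).trans hO
  let J := O × (ι × Fin (m + 1))
  let s : ι × Fin (m + 1) → S := fun x => b x.1 * T ^ (x.2 : ℕ)
  let s' : ι × Fin (m + 1) → S := fun x => b' x.1 * T ^ (x.2 : ℕ)
  have hs : ∀ x, s x ∈ 𝓕.V (m + C) := fun x =>
    𝓕.mono (by have := x.2.2; omega) (𝓕.base_mul_pow_mem x.1 x.2)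
  have hs' : ∀ x, s' x ∈ 𝓕.V (m + C) := fun x => by
    refine 𝓕.mono (by have := x.2.2; omega : C + 1 * (x.2 : ℕ) ≤ m + C) ?_
    exact 𝓕.mul_mem (hb' _) (𝓕.pow_mem 𝓕.gen_mem _)
  let F : (J → k) →ₗ[k] S := Fintype.linearCombination k fun x : J => w x.1 ^ p ^ μ * s' x.2
  have hF : ∀ c, F c ∈ 𝓕.V ((l + C) * p ^ μ + (m + C)) := by
    intro c
    rw [Fintype.linearCombination_apply]
    exact Submodule.sum_mem _ fun x _ => Submodule.smul_mem _ _
      (𝓕.mul_mem (𝓕.pow_mem (hw _ x.1.2).1 _) (hs' _))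
  have hker : LinearMap.ker (F.codRestrict _ hF) ≠ ⊥ := by
    refine LinearMap.ker_ne_bot_of_finrank_lt ?_
    rw [Module.finrank_fintype_fun_eq_card]
    refine (𝓕.finrank_le _).trans_lt ?_
    simp only [J, Fintype.card_prod, Fintype.card_coe, Fintype.card_fin]
    calc _ = Fintype.card ι * ((l + C) * p ^ μ + m + C + 1) := by ring
      _ < _ := hdim
      _ ≤ _ := Nat.mul_le_mul_right _ hOcard
  obtain ⟨c, hc, hc0⟩ := (Submodule.ne_bot_iff _).1 hker
  rw [LinearMap.ker_codRestrict, LinearMap.mem_ker, Fintype.linearCombination_apply] at hc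
  have hroot : ∀ x, ∃ e : k, e ^ (p ^ ν * p ^ μ) = c x := fun x =>
    IsAlgClosed.exists_pow_nat_eq _ (by positivity)
  choose e he using hroot
  let g : O → S := fun n => ∑ x, e (n, x) • s x
  let h : S := ∑ n : O, w n * g n ^ p ^ ν
  have hgmem : ∀ n, g n ∈ 𝓕.V (m + C) := fun n =>
    Submodule.sum_mem _ fun x _ => Submodule.smul_mem _ _ (hs x)
  have hmem : h ∈ 𝓕.V (l + C + (m + C) * p ^ ν) :=
    Submodule.sum_mem _ fun n _ => 𝓕.mul_mem (hw _ n.2).1 (𝓕.pow_mem (hgmem n) _)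
  have hg0 : ∃ n, g n ≠ 0 := by
    by_contra! hg0
    apply hc0
    funext ⟨n, x⟩
    have hli : LinearIndependent k s := by
      refine 𝓕.linearIndependent.comp (fun x : ι × Fin (m + 1) => (x.1, (x.2 : ℕ))) ?_
      rintro ⟨x, i⟩ ⟨y, j⟩ h
      simp only [Prod.mk.injEq] at h
      exact Prod.ext h.1 (Fin.ext h.2)
    have := Fintype.linearIndependent_iff.1 hli (fun x => e (n, x)) (hg0 n) x
    rw [← he, this, zero_pow (by positivity)]
    rfl
  have hh0 : h ≠ 0 := by
    obtain ⟨n₀, hn₀⟩ := hg0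
    have hval : ∀ n : O, v (w n * g n ^ p ^ ν) = (n : ℕ) + (p ^ ν : ℕ) * v (g n) := by
      intro n
      rw [v.map_mul, v.map_pow, (hw n n.2).2.1, nsmul_eq_mul]
    have hfin : ∀ n : O, v (w n * g n ^ p ^ ν) ≠ ⊤ → ∃ a : ℕ, v (g n) = a := by
      intro n hn
      refine ⟨(v (g n)).toNat, (ENat.natCast_toNat fun htop => hn ?_).symm⟩
      rw [hval, htop, ENat.mul_top (by positivity)]
      simp
    obtain ⟨n, -, hn, hnt⟩ := IsPointOrder.map_sum_ne_top (v := v) Finset.univ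
      (fun n : O => w n * g n ^ p ^ ν) (by
        intro i _ j _ hi hij
        obtain ⟨a, ha⟩ := hfin i hi
        obtain ⟨a', ha'⟩ := hfin j (hij ▸ hi)
        rw [hval, hval, ha, ha'] at hij
        have hij' : (i : ℕ) + p ^ ν * a = j + p ^ ν * a' := by exact_mod_cast hij
        have h1 := (hw i i.2).2.2
        have h2 := (hw j j.2).2.2
        have h3 := congrArg (· % p ^ ν) hij'
        simp only [Nat.add_mul_mod_self_left] at h3
        rw [Nat.mod_eq_of_lt (by omega), Nat.mod_eq_of_lt (by omega)] at h3
        exact Subtype.ext h3)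
      ⟨n₀, Finset.mem_univ _, fun htop => by
        have := hv.eq_zero _ htop
        rcases mul_eq_zero.1 this with h' | h'
        · have h2 := (hw _ n₀.2).2.1
          rw [h', v.map_zero] at h2
          exact ENat.natCast_ne_top _ h2.symm
        · exact hn₀ (pow_eq_zero_iff (by positivity) |>.1 h')⟩
    intro h0
    change v h = _ at hn
    rw [h0, v.map_zero] at hn
    exact hnt hn.symm
  have hzero : ∀ φ ∈ Φ, φ h = 0 := by
    intro φ hφ
    have hpow : φ h ^ p ^ μ = φ (∑ x : J, c x • (w x.1 ^ p ^ μ * s' x.2)) := by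
      rw [← map_pow, sum_pow_char_pow, map_sum, map_sum]
      simp only [J, Fintype.sum_prod_type (α₁ := O)]
      refine Finset.sum_congr rfl fun n _ => ?_
      rw [mul_pow, ← pow_mul, ← pow_add, sum_pow_char_pow, map_mul, map_sum, Finset.mul_sum]
      refine Finset.sum_congr rfl fun x _ => ?_
      have hTx : φ T ^ ((x.2 : ℕ) * (p ^ ν * p ^ μ)) = φ T ^ (x.2 : ℕ) := by
        rw [mul_comm, pow_mul, hΦT φ hφ]
      simp only [s, s', map_mul, map_pow, map_smul, _root_.smul_pow, pow_add, mul_pow, ← pow_mul,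
        ← he, smul_eq_mul]
      rw [← hΦ φ hφ x.1, hTx]
      ring
    rw [hc, map_zero] at hpow
    exact pow_eq_zero_iff (by positivity) |>.1 hpow
  refine (𝓕.card_zeros_le hmem hh0 Φ hzero).trans (le_of_eq ?_)
  ring

end LinearFiltration

theorem exists_parameters_aux {D C B M Q : ℕ} (hD : 1 ≤ D)
    (hM : D * D * (2 * C + 3) + D * B + (D + 2 * C * D) * (C + 2) + 2 * C + 3 < M) (hQ : M ≤ Q) :
    ∃ l m : ℕ, D * (l + C + C) < Q ∧
      D * ((l + C) * M + m + C + 1) < D * (l + 1) * (D * (m + 1)) ∧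
      (D - 1) * (D * (l + C + Q * (m + C) + C)) + D * B < D * (Q * M) := by
  obtain ⟨a, ha⟩ : ∃ a, a = Q / D := ⟨_, rfl⟩
  obtain ⟨c, hc⟩ : ∃ c, c = M / D := ⟨_, rfl⟩
  have ha1 : D * a ≤ Q := ha ▸ Nat.mul_div_le Q D
  have ha2 : Q < D * a + D := by rw [ha]; have := Nat.lt_mul_div_succ Q hD; lia
  have hc1 : D * c ≤ M := hc ▸ Nat.mul_div_le M D
  have hc2 : M < D * c + D := by rw [hc]; have := Nat.lt_mul_div_succ M hD; lia
  clear ha hc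
  have haC : 2 * C + 1 ≤ a := by
    by_contra! h
    have : D * a ≤ D * (2 * C) := Nat.mul_le_mul_left _ (by omega)
    nlinarith
  obtain ⟨l, rfl⟩ := Nat.exists_eq_add_of_le haC
  refine ⟨l, c + C + 2, by nlinarith, ?_, ?_⟩
  · rw [mul_assoc]
    refine Nat.mul_lt_mul_of_pos_left ?_ hD
    have h1 : M + D * (C + 2) ≤ D * (c + C + 2 + 1) := by nlinarith
    have h2 : c ≤ M := by nlinarith
    calc _ < (l + 1) * (M + D * (C + 2)) := by
          have : M < D * (l + 1) + (2 * C + 1) * D := by nlinarith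
          nlinarith
      _ ≤ _ := Nat.mul_le_mul_left _ h1
  · obtain ⟨E, rfl⟩ := Nat.exists_eq_add_of_le' hD
    simp only [Nat.add_sub_cancel]
    have h0 : l + C + C ≤ Q := by nlinarith
    have h1 : (E + 1) * (l + C + Q * (c + C + 2 + C) + C) ≤ Q * M + (E + 1) * Q * (2 * C + 3) := by
      have := Nat.mul_le_mul_left Q hc1
      nlinarith
    have h2 : (E + 1) * Q * (2 * C + 3) * E + (E + 1) * B < Q * M := by
      have h3 : (E + 1) * (E + 1) * (2 * C + 3) + (E + 1) * B < M := by
        have := Nat.zero_le ((E + 1 + 2 * C * (E + 1)) * (C + 2))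
        linarith
      have hQ1 : 1 ≤ Q := by omega
      have h4 : Q * ((E + 1) * (E + 1) * (2 * C + 3) + (E + 1) * B) < Q * M :=
        Nat.mul_lt_mul_of_pos_left h3 hQ1
      have h5 : (E + 1) * B ≤ Q * ((E + 1) * B) := Nat.le_mul_of_pos_left _ hQ1
      nlinarith [Nat.zero_le ((E + 1) * Q * (2 * C + 3))]
    nlinarith

theorem exists_parameters (D C B : ℕ) (hD : 1 ≤ D) :
    ∃ n₀ : ℕ, ∀ n, n₀ ≤ n → ∃ μ ν l m : ℕ, ν + μ = n ∧ D * (l + C + C) < 2 ^ ν ∧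
      D * ((l + C) * 2 ^ μ + m + C + 1) < D * (l + 1) * (D * (m + 1)) ∧
      (D - 1) * (D * (l + C + 2 ^ ν * (m + C) + C)) + D * B < D * 2 ^ n := by
  refine ⟨2 * (D * D * (2 * C + 3) + D * B + (D + 2 * C * D) * (C + 2) + 2 * C + 3),
    fun n hn => ?_⟩
  obtain ⟨l, m, h1, h2, h3⟩ := exists_parameters_aux (D := D) (C := C) (B := B) (M := 2 ^ (n / 2))
    (Q := 2 ^ (n - n / 2)) hD (lt_of_le_of_lt (by omega) Nat.lt_two_pow_self)
    (Nat.pow_le_pow_right (by norm_num) (by omega))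
  refine ⟨n / 2, n - n / 2, l, m, by omega, h1, h2, ?_⟩
  rwa [← pow_add, show n - n / 2 + n / 2 = n by omega] at h3

/-- Every rational point of a smooth affine curve has an order of vanishing. -/
theorem exists_isPointOrder {k S : Type*} [Field k] [CommRing S] [IsDedekindDomain S]
    [Algebra k S] (hS : ¬ IsField S) (φ : S →ₐ[k] k) :
    ∃ v : AddValuation S ℕ∞, IsPointOrder k v ∧ ∀ x, φ x = 0 → 1 ≤ v x := by
  have hsurj : Function.Surjective φ := fun c => ⟨algebraMap k S c, by simp⟩
  have hmax : (RingHom.ker φ).IsMaximal := RingHom.ker_isMaximal_of_surjective φ hsurj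
  set P := RingHom.ker φ with hP
  have hP0 : P ≠ ⊥ := fun h => hS (by
    rw [h] at hmax
    exact Ring.isField_iff_maximal_bot.2 hmax)
  let R := Localization.AtPrime P
  have hdvr : IsDiscreteValuationRing R :=
    IsLocalization.AtPrime.isDiscreteValuationRing_of_dedekind_domain S hP0 R
  have hinj : Function.Injective (algebraMap S R) :=
    IsLocalization.injective R P.primeCompl_le_nonZeroDivisors
  let v : AddValuation S ℕ∞ := (IsDiscreteValuationRing.addVal R).comap (algebraMap S R)
  have hv : ∀ x, v x = IsDiscreteValuationRing.addVal R (algebraMap S R x) := fun x => rfl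
  have hpos : ∀ x, φ x = 0 → 1 ≤ v x := by
    intro x hx
    rw [Order.one_le_iff_ne_zero, hv, Ne, IsDiscreteValuationRing.addVal_eq_zero_iff,
      IsLocalization.AtPrime.isUnit_to_map_iff R P]
    exact fun h => h hx
  refine ⟨v, ⟨fun x hx => ?_, fun x y n hx hy => ?_, ?_⟩, hpos⟩
  · rw [hv, IsDiscreteValuationRing.addVal_eq_top_iff] at hx
    exact hinj (hx.trans (map_zero _).symm)
  · obtain ⟨u, hu⟩ := (IsDiscreteValuationRing.addVal_eq_iff_associated _ _).1
      ((hv y).symm.trans (hy.trans hx.symm))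
    obtain ⟨⟨a, s⟩, has⟩ := IsLocalization.surj P.primeCompl (u : R)
    have hxy : (s : S) * x = a * y := by
      apply hinj
      rw [map_mul, map_mul, ← hu, ← has]
      ring
    have hs : φ s ≠ 0 := s.2
    refine ⟨φ a / φ s, ?_⟩
    have key : φ s • (x - (φ a / φ s) • y) =
        (algebraMap k S (φ s) - s) * x + (a - algebraMap k S (φ a)) * y := by
      rw [smul_sub, smul_smul, mul_div_cancel₀ _ hs, Algebra.smul_def, Algebra.smul_def]
      linear_combination hxy
    rw [← IsPointOrder.map_smul (v := v) hs, key]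
    refine lt_of_lt_of_le ?_ (v.map_add _ _)
    have h1 : ∀ z w : S, φ z = 0 → v w = n → (n : ℕ∞) < v (z * w) := by
      intro z w hz hw
      rw [v.map_mul, hw, add_comm]
      exact lt_of_lt_of_le (by exact_mod_cast Nat.lt_succ_self n)
        (add_le_add_right (hpos z hz) _)
    exact lt_min (h1 _ _ (by simp) hx) (h1 _ _ (by simp) hy)
  · obtain ⟨ϖ, hϖ⟩ := IsDiscreteValuationRing.exists_irreducible R
    obtain ⟨⟨a, s⟩, has⟩ := IsLocalization.surj P.primeCompl ϖ
    refine ⟨a, ?_⟩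
    have hs : IsUnit (algebraMap S R s) := IsLocalization.map_units R s
    rw [hv, ← has, IsDiscreteValuationRing.addVal_mul,
      IsDiscreteValuationRing.addVal_uniformizer hϖ,
      IsDiscreteValuationRing.addVal_eq_zero_iff.2 hs, add_zero]

section InfinitePlace

variable {k S Γ : Type*} [Field k] [CommRing S] [Algebra k S] [LinearOrderedCommGroupWithZero Γ]

/-- A valuation that is trivial on constants and has a pole at `T`. -/
structure IsPlaceAtInfinity (k : Type*) {S Γ : Type*} [Field k] [CommRing S] [Algebra k S]
    [LinearOrderedCommGroupWithZero Γ] (v : Valuation S Γ) (T : S) : Prop where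
  map_algebraMap_le : ∀ c : k, v (algebraMap k S c) ≤ 1
  one_lt : 1 < v T

/-- A root of a monic polynomial is at most as large as its coefficients allow. -/
theorem Valuation.le_of_eval_eq_zero (v : Valuation S Γ) {u : Γ} {p : S[X]} (hp : p.Monic) {f : S}
    (hf : p.eval f = 0) (hu : ∀ i < p.natDegree, v (p.coeff i) ≤ u ^ (p.natDegree - i)) :
    v f ≤ u := by
  by_contra! h
  have hpos : 0 < v f := lt_of_le_of_lt zero_le h
  have h1 : f ^ p.natDegree = -∑ i ∈ Finset.range p.natDegree, p.coeff i * f ^ i := by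
    rw [Polynomial.eval_eq_sum_range, Finset.sum_range_succ, hp.coeff_natDegree, one_mul] at hf
    linear_combination hf
  have h2 : v (f ^ p.natDegree) < v f ^ p.natDegree := by
    rw [h1, Valuation.map_neg]
    refine v.map_sum_lt (pow_pos hpos _).ne' fun i hi => ?_
    rw [Finset.mem_range] at hi
    rw [map_mul, map_pow]
    calc _ ≤ u ^ (p.natDegree - i) * v f ^ i := mul_le_mul_left (hu i hi) _
      _ < v f ^ (p.natDegree - i) * v f ^ i :=
        (mul_lt_mul_iff_left₀ (pow_pos hpos _)).2 (pow_lt_pow_left₀ h zero_le (by omega))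
      _ = _ := by rw [← pow_add]; congr 1; omega
  rw [map_pow] at h2
  exact lt_irrefl _ h2

namespace IsPlaceAtInfinity

variable {v : Valuation S Γ} {T : S} (hv : IsPlaceAtInfinity k v T)
include hv

theorem map_algebraMap {c : k} (hc : c ≠ 0) : v (algebraMap k S c) = 1 := by
  refine le_antisymm (hv.map_algebraMap_le c) ?_
  have h : v (algebraMap k S c) * v (algebraMap k S c⁻¹) = 1 := by
    rw [← map_mul, ← map_mul, mul_inv_cancel₀ hc, map_one, map_one]
  rw [← h]
  exact mul_le_of_le_one_right' (hv.map_algebraMap_le c⁻¹)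

theorem map_aeval_le (p : k[X]) {e : ℕ} (he : p.natDegree ≤ e) : v (aeval T p) ≤ v T ^ e := by
  rw [aeval_eq_sum_range]
  refine v.map_sum_le fun i hi => ?_
  rw [Finset.mem_range] at hi
  rw [Algebra.smul_def, map_mul, map_pow]
  exact (mul_le_of_le_one_left' (hv.map_algebraMap_le _)).trans
    (pow_le_pow_right₀ hv.one_lt.le (by omega))

theorem map_aeval {p : k[X]} (hp : p ≠ 0) : v (aeval T p) = v T ^ p.natDegree := by
  by_cases h0 : p.natDegree = 0
  · rw [h0, pow_zero, eq_C_of_natDegree_eq_zero h0, aeval_C, hv.map_algebraMap]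
    intro h
    exact hp (by rw [eq_C_of_natDegree_eq_zero h0, h, C_0])
  have h1 : aeval T p = algebraMap k S p.leadingCoeff * T ^ p.natDegree + aeval T p.eraseLead := by
    conv_lhs => rw [← p.eraseLead_add_C_mul_X_pow]
    rw [map_add, map_mul, aeval_C, map_pow, aeval_X, add_comm]
  have h2 : v (algebraMap k S p.leadingCoeff * T ^ p.natDegree) = v T ^ p.natDegree := by
    rw [map_mul, map_pow, hv.map_algebraMap (leadingCoeff_ne_zero.2 hp), one_mul]
  have h3 : v (aeval T p.eraseLead) < v T ^ p.natDegree :=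
    (hv.map_aeval_le _ p.eraseLead_natDegree_le).trans_lt
      (pow_lt_pow_right₀ hv.one_lt (by omega))
  rw [h1, v.map_add_eq_of_lt_left (by rwa [h2]), h2]

theorem one_le_map_aeval {p : k[X]} (hp : p ≠ 0) : 1 ≤ v (aeval T p) := by
  rw [hv.map_aeval hp]
  exact one_le_pow₀ hv.one_lt.le

end IsPlaceAtInfinity

theorem exists_isPlaceAtInfinity.{u} {S : Type u} [CommRing S] [IsDomain S] [Algebra k[X] S]
    [FaithfulSMul k[X] S] [Algebra k S] [IsScalarTower k k[X] S] :
    ∃ (Γ : Type u)  (_ : LinearOrderedCommGroupWithZero Γ) (v : Valuation S Γ),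
      IsPlaceAtInfinity k v (algebraMap k[X] S X) := by
  let K := FractionRing S
  set t : K := algebraMap S K (algebraMap k[X] S X) with ht
  have hinj : Function.Injective (algebraMap S K) := IsFractionRing.injective S K
  have hinj2 : Function.Injective (algebraMap k[X] S) := FaithfulSMul.algebraMap_injective _ _
  have hinj3 : ∀ p : k[X], aeval t p = 0 → p = 0 := by
    intro p hp
    have : aeval t p = algebraMap S K (algebraMap k[X] S p) := by
      rw [ht, aeval_algebraMap_apply]
      congr 1
      have := aeval_algebraMap_apply S (X : k[X]) p
      rw [this, aeval_X_left_apply]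
    rw [this] at hp
    exact hinj2 (hinj (by simpa using hp) |>.trans (map_zero _).symm)
  have ht0 : t ≠ 0 := fun h => X_ne_zero (hinj3 X (by simpa using h))
  let A : Subring K := (aeval (R := k) t⁻¹).toRingHom.range
  let f : k[X] →+* A := (aeval (R := k) t⁻¹).toRingHom.rangeRestrict
  let I : Ideal A := Ideal.span {f X}
  have hI : I ≠ ⊤ := by
    rw [Ne, Ideal.eq_top_iff_one, Ideal.mem_span_singleton]
    rintro ⟨⟨-, p, rfl⟩, hp⟩
    have hp' : (1 : K) = t⁻¹ * aeval t⁻¹ p := by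
      have := congrArg Subtype.val hp
      rw [Subring.coe_one, Subring.coe_mul] at this
      rw [this]
      exact congrArg (· * _) (aeval_X (R := k) t⁻¹)
    set q : k[X] := X * p - 1 with hq
    have hq0 : aeval t⁻¹ q = 0 := by rw [hq]; simp [← hp']
    have hq1 : aeval t q.reverse = 0 := by
      let := invertibleOfNonzero (inv_ne_zero ht0)
      have h := (eval₂_reverse_eq_zero_iff (algebraMap k K) t⁻¹ q).2 hq0
      rwa [invOf_eq_inv, inv_inv] at h
    have := hinj3 _ hq1
    rw [reverse_eq_zero] at this
    have h0 : q.coeff 0 = -1 := by simp [hq]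
    rw [this] at h0
    simp at h0
  obtain ⟨𝒪, h1, h2⟩ := Ideal.image_subset_nonunits_valuationSubring I hI
  refine ⟨_, inferInstance, 𝒪.valuation.comap (algebraMap S K), ⟨fun c => ?_, ?_⟩⟩
  · rw [Valuation.comap_apply, ValuationSubring.valuation_le_one_iff]
    refine h1 ⟨C c, ?_⟩
    simp [IsScalarTower.algebraMap_apply k S K]
  · rw [Valuation.comap_apply, ← ht]
    have h3 : t⁻¹ ∈ 𝒪.nonunits := h2 ⟨f X, Ideal.subset_span rfl, aeval_X (R := k) t⁻¹⟩
    rw [ValuationSubring.mem_nonunits_iff, map_inv₀] at h3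
    exact (inv_lt_one₀ ((Valuation.pos_iff _).2 ht0)).1 h3

end InfinitePlace

section Filtration

variable {k S Γ G : Type*} [Field k] [CommRing S] [IsDomain S] [Algebra k S] [Algebra k[X] S]
  [IsScalarTower k k[X] S] [FaithfulSMul k[X] S] [Module.Finite k[X] S] [Group G] [Finite G]
  [MulSemiringAction G S] [hG : IsGaloisGroup G k[X] S] [LinearOrderedCommGroupWithZero Γ]

theorem algebraMap_polynomial_apply {k S : Type*} [CommSemiring k] [CommSemiring S] [Algebra k S]
    [Algebra k[X] S] [IsScalarTower k k[X] S] (p : k[X]) :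
    algebraMap k[X] S p = aeval (algebraMap k[X] S X) p := by
  have := aeval_algebraMap_apply S (X : k[X]) p
  rw [this, aeval_X_left_apply]

omit [IsDomain S] [IsScalarTower k k[X] S] [FaithfulSMul k[X] S] [Module.Finite k[X] S]
  [Finite G] in
include hG in
variable (G) in
theorem IsGaloisGroup.smul_algebraMap_const [IsScalarTower k k[X] S] (σ : G) (c : k) :
    σ • algebraMap k S c = algebraMap k S c := by
  have := hG.commutes
  rw [IsScalarTower.algebraMap_apply k k[X] S, smul_algebraMap]

set_option linter.unusedSectionVars false

namespace IsPlaceAtInfinity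

variable {v : Valuation S Γ} (hv : IsPlaceAtInfinity k v (algebraMap k[X] S X))
include hv hG

/-- A function on an affine Galois cover of the line all of whose conjugates vanish at a place at
infinity is zero. -/
theorem eq_zero_of_lt_one {f : S} (hf : ∀ σ : G, v (σ • f) < 1) : f = 0 := by
  have := Fintype.ofFinite G
  have := hG.isInvariant
  classical
  obtain ⟨p, hp⟩ := Algebra.IsInvariant.isInvariant (A := k[X]) (G := G) (∏ σ : G, σ • f) (by
    intro τ
    rw [Finset.smul_prod']
    exact Fintype.prod_equiv (Equiv.mulLeft τ) _ _ fun σ => by simp [mul_smul])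
  have hlt : v (algebraMap k[X] S p) < 1 := by
    rw [hp, ← Finset.mul_prod_erase _ _ (Finset.mem_univ (1 : G)), map_mul, map_prod]
    exact mul_lt_one_of_lt_of_le (hf 1) (Finset.prod_le_one' fun σ _ => (hf σ).le)
  have hp0 : p = 0 := by
    by_contra h
    have := hv.one_le_map_aeval h
    rw [← algebraMap_polynomial_apply] at this
    exact absurd hlt this.not_gt
  rw [hp0, map_zero, eq_comm, Finset.prod_eq_zero_iff] at hp
  obtain ⟨σ, -, hσ⟩ := hp
  exact (smul_eq_zero_iff_eq σ).1 hσ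

theorem exists_le_pow (f : S) : ∃ e : ℕ, ∀ σ : G, v (σ • f) ≤ v (algebraMap k[X] S X) ^ e := by
  have := hG.commutes
  obtain ⟨p, hp, hpf⟩ := Algebra.IsIntegral.isIntegral (R := k[X]) f
  refine ⟨p.support.sup fun i => (p.coeff i).natDegree, fun σ => ?_⟩
  refine v.le_of_eval_eq_zero (hp.map (algebraMap k[X] S)) ?_ fun i hi => ?_
  · rw [eval_map_algebraMap]
    change aeval (MulSemiringAction.toAlgHom k[X] S σ f) p = 0
    rw [aeval_algHom_apply, aeval_def, hpf, map_zero]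
  · rw [coeff_map, algebraMap_polynomial_apply, ← pow_mul]
    refine hv.map_aeval_le _ ?_
    by_cases h : i ∈ p.support
    · exact (Finset.le_sup (f := fun i => (p.coeff i).natDegree) h).trans
        (Nat.le_mul_of_pos_right _ (by omega))
    · rw [notMem_support_iff.1 h]
      simp

variable (G) in
/-- The functions with poles of order at most `e` at infinity. -/
def sections (e : ℕ) : Submodule k S where
  carrier := {f | ∀ σ : G, v (σ • f) ≤ v (algebraMap k[X] S X) ^ e}
  add_mem' := fun ha hb σ => by
    rw [smul_add]
    exact v.map_add_le (ha σ) (hb σ)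
  zero_mem' := fun σ => by simp
  smul_mem' := fun c f hf σ => by
    rw [Algebra.smul_def, smul_mul', IsGaloisGroup.smul_algebraMap_const, map_mul]
    exact (mul_le_of_le_one_left' (hv.map_algebraMap_le c)).trans (hf σ)

theorem exists_injective_sections (e : ℕ) :
    ∃ L : hv.sections G e →ₗ[k] (Fin (Module.finrank k[X] S) × Fin (e + 1) → k),
      Function.Injective L := by
  have := hG.commutes
  have : Module.IsTorsionFree k[X] S := inferInstance
  let β := Module.finBasis k[X] S
  let L : hv.sections G e →ₗ[k] (Fin (Module.finrank k[X] S) × Fin (e + 1) → k) :=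
    { toFun := fun f x => (β.repr f x.1).coeff x.2
      map_add' := fun f g => by ext; simp
      map_smul' := fun c f => by
        ext x
        have h : c • (f : S) = (C c : k[X]) • (f : S) := by
          rw [Algebra.smul_def, Algebra.smul_def, IsScalarTower.algebraMap_apply k k[X] S]
          rfl
        simp [h] }
  refine ⟨L, (injective_iff_map_eq_zero L).2 fun f hf => ?_⟩
  have hdvd : ∀ j, (X : k[X]) ^ (e + 1) ∣ β.repr f j := by
    intro j
    rw [X_pow_dvd_iff]
    exact fun i hi => congrFun hf (j, ⟨i, hi⟩)
  choose g hg using hdvd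
  let h : S := ∑ j, g j • β j
  have hfh : (f : S) = algebraMap k[X] S X ^ (e + 1) * h := by
    rw [← β.sum_repr f, Finset.mul_sum]
    refine Finset.sum_congr rfl fun j _ => ?_
    rw [hg, Algebra.smul_def, Algebra.smul_def, map_mul, map_pow, mul_assoc]
  have hpos : 0 < v (algebraMap k[X] S X) := lt_trans zero_lt_one hv.one_lt
  have h0 : h = 0 := by
    refine hv.eq_zero_of_lt_one (G := G) fun σ => ?_
    by_contra! hge
    have h1 := f.2 σ
    rw [hfh, smul_mul', smul_pow', smul_algebraMap, map_mul, map_pow] at h1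
    have h2 : v (algebraMap k[X] S X) ^ e < v (algebraMap k[X] S X) ^ (e + 1) :=
      pow_lt_pow_right₀ hv.one_lt (by omega)
    exact absurd (h2.trans_le (le_mul_of_one_le_right' hge)) h1.not_gt
  exact Subtype.ext (by rw [hfh, h0, mul_zero]; rfl)

/-- The filtration by pole order at infinity on an affine Galois cover of the line. -/
def filtration {ι : Type*} [Fintype ι] {b : ι → S} {C : ℕ}
    (hcard : Fintype.card ι = Module.finrank k[X] S) (hb : LinearIndependent k[X] b)
    (hbC : ∀ i, b i ∈ hv.sections G C) :
    LinearFiltration k b (algebraMap k[X] S X) C where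
  V := hv.sections G
  mono := fun i j hij f hf σ => (hf σ).trans (pow_le_pow_right₀ hv.one_lt.le hij)
  mul_mem := fun hx hy σ => by
    rw [smul_mul', map_mul, pow_add]
    exact mul_le_mul' (hx σ) (hy σ)
  one_mem := fun σ => by simp
  exists_mem := hv.exists_le_pow
  finite := fun e => by
    obtain ⟨L, hL⟩ := hv.exists_injective_sections (G := G) e
    exact FiniteDimensional.of_injective L hL
  finrank_le := fun e => by
    obtain ⟨L, hL⟩ := hv.exists_injective_sections (G := G) e
    have := LinearMap.finrank_le_finrank_of_injective hL
    rw [Module.finrank_fintype_fun_eq_card, Fintype.card_prod, Fintype.card_fin,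
      Fintype.card_fin] at this
    rwa [hcard]
  gen_mem := fun σ => by
    have := hG.commutes
    rw [smul_algebraMap, pow_one]
  base_mem := hbC
  linearIndependent := by
    have h := linearIndependent_smul (basisMonomials k).linearIndependent hb
    convert h.comp (Equiv.prodComm ι ℕ) (Equiv.injective _) using 1
    funext x
    simp [Algebra.smul_def, mul_comm, ← X_pow_eq_monomial]

end IsPlaceAtInfinity

end Filtration

section Inertia

variable {k S G : Type*} [Field k] [CommRing S] [IsDedekindDomain S] [Algebra k S] [Algebra k[X] S]
  [IsScalarTower k k[X] S] [FaithfulSMul k[X] S] [Module.Finite k[X] S] [Group G] [Finite G]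
  [MulSemiringAction G S] [hG : IsGaloisGroup G k[X] S]

theorem not_isField_of_isIntegral_polynomial {k S : Type*} [Field k] [CommRing S]
    [Algebra k[X] S] [FaithfulSMul k[X] S] [Algebra.IsIntegral k[X] S] : ¬ IsField S := fun h =>
  Polynomial.not_isField k
    (isField_of_isIntegral_of_isField (FaithfulSMul.algebraMap_injective k[X] S) h)

include hG in
/-- Inertia is nontrivial at a point where the coordinate of the base vanishes doubly. -/
theorem exists_ne_one_forall_map_smul_eq (φ : S →ₐ[k] k)
    (hφ : algebraMap k[X] S X - algebraMap k S (φ (algebraMap k[X] S X)) ∈ RingHom.ker φ ^ 2) :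
    ∃ σ : G, σ ≠ 1 ∧ ∀ x, φ (σ • x) = φ x := by
  have := Fintype.ofFinite G
  have := hG.isInvariant
  classical
  by_contra! hcon
  obtain ⟨v, hv, hpos⟩ := exists_isPointOrder (not_isField_of_isIntegral_polynomial (k := k)) φ
  obtain ⟨π, hπ⟩ := hv.exists_uniformizer
  have hsq : ∀ x ∈ RingHom.ker φ ^ 2, 2 ≤ v x := by
    intro x hx
    rw [pow_two] at hx
    refine Submodule.mul_induction_on hx (fun a ha b hb => ?_) fun a b ha hb =>
      (le_min ha hb).trans (v.map_add _ _)
    rw [v.map_mul]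
    exact add_le_add (hpos a ha) (hpos b hb)
  let ψ : G → S →ₐ[k] k := fun σ =>
    { (φ : S →+* k).comp (MulSemiringAction.toRingHom G S σ) with
      commutes' := fun c => by
        change φ (σ • algebraMap k S c) = _
        rw [IsGaloisGroup.smul_algebraMap_const, AlgHom.commutes] }
  have hψ : ∀ σ x, ψ σ x = φ (σ • x) := fun σ x => rfl
  have hmax : ∀ σ, (RingHom.ker (ψ σ)).IsMaximal := fun σ =>
    RingHom.ker_isMaximal_of_surjective _ fun c => ⟨algebraMap k S c, by simp⟩
  have hne : ∀ σ τ, RingHom.ker (ψ σ) = RingHom.ker (ψ τ) → σ = τ := by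
    intro σ τ h
    by_contra hστ
    obtain ⟨x, hx⟩ := hcon (σ * τ⁻¹) (by rwa [Ne, mul_inv_eq_one])
    apply hx
    have : τ⁻¹ • x - algebraMap k S (φ x) ∈ RingHom.ker (ψ τ) := by
      rw [RingHom.mem_ker, map_sub, hψ, smul_inv_smul, AlgHom.commutes]
      simp
    rw [← h, RingHom.mem_ker, map_sub, hψ, AlgHom.commutes, sub_eq_zero, smul_smul] at this
    exact this
  let I : G → Ideal S := fun σ => if σ = 1 then RingHom.ker (ψ σ) ^ 2 else RingHom.ker (ψ σ)
  have hI : Pairwise (Function.onFun IsCoprime I) := by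
    intro σ τ hστ
    have h : IsCoprime (RingHom.ker (ψ σ)) (RingHom.ker (ψ τ)) :=
      Ideal.isCoprime_of_isMaximal fun h => hστ (hne σ τ h)
    simp only [Function.onFun, I]
    split_ifs
    · exact h.pow
    · exact h.pow_left
    · exact h.pow_right
    · exact h
  obtain ⟨f, hf⟩ := Ideal.exists_forall_sub_mem_ideal hI (fun σ => if σ = 1 then π else 1)
  have hf1 : f - π ∈ RingHom.ker φ ^ 2 := by
    have := hf 1
    simp only [I, if_true] at this
    convert this
    ext x
    simp [hψ]
  have hfσ : ∀ σ : G, σ ≠ 1 → φ (σ • f) = 1 := by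
    intro σ hσ
    have := hf σ
    simp only [I, if_neg hσ] at this
    rw [RingHom.mem_ker, map_sub, map_one, hψ, sub_eq_zero] at this
    exact this
  have hv1 : v f = 1 := by
    have : f = π + (f - π) := by ring
    rw [this, v.map_add_eq_of_lt_left, hπ]
    rw [hπ]
    exact lt_of_lt_of_le (by norm_num) (hsq _ hf1)
  have hv0 : ∀ x, φ x = 1 → v x = 0 := by
    intro x hx
    have : x = 1 + (x - 1) := by ring
    rw [this, v.map_add_eq_of_lt_left, v.map_one]
    rw [v.map_one]
    exact lt_of_lt_of_le (by norm_num) (hpos _ (by simp [hx]))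
  obtain ⟨p, hp⟩ := Algebra.IsInvariant.isInvariant (A := k[X]) (G := G) (∏ σ : G, σ • f) (by
    intro τ
    rw [Finset.smul_prod']
    exact Fintype.prod_equiv (Equiv.mulLeft τ) _ _ fun σ => by simp [mul_smul])
  have hvN : v (algebraMap k[X] S p) = 1 := by
    rw [hp, ← Finset.mul_prod_erase _ _ (Finset.mem_univ (1 : G)), v.map_mul, one_smul, hv1,
      hv0, add_zero]
    rw [map_prod]
    refine Finset.prod_eq_one fun σ hσ => hfσ σ (Finset.ne_of_mem_erase hσ)
  set t₀ := φ (algebraMap k[X] S X) with ht₀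
  have hφf : φ f = 0 := by
    have h1 : φ (f - π) = 0 := Ideal.pow_le_self two_ne_zero hf1
    have h2 : φ π = 0 := by
      by_contra h
      have h3 : v ((φ π)⁻¹ • π) = 0 := hv0 _ (by simp [h])
      rw [IsPointOrder.map_smul (inv_ne_zero h), hπ] at h3
      exact one_ne_zero h3
    rw [map_sub, h2, sub_zero] at h1
    exact h1
  have hroot : p.IsRoot t₀ := by
    have h1 : φ (algebraMap k[X] S p) = 0 := by
      rw [hp, ← Finset.mul_prod_erase _ _ (Finset.mem_univ (1 : G)), map_mul, one_smul, hφf,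
        zero_mul]
    rwa [algebraMap_polynomial_apply, ← aeval_algHom_apply, coe_aeval_eq_eval] at h1
  obtain ⟨g, hg⟩ := dvd_iff_isRoot.2 hroot
  have hlin : algebraMap k[X] S (X - C t₀) = algebraMap k[X] S X - algebraMap k S t₀ := by
    rw [map_sub, IsScalarTower.algebraMap_apply k k[X] S]
    rfl
  have : 2 ≤ v (algebraMap k[X] S p) := by
    rw [hg, map_mul, v.map_mul, hlin]
    exact le_add_right (hsq _ hφ)
  rw [hvN] at this
  exact absurd this (by norm_num)

end Inertia

section Separation

variable {k S Γ : Type*} [Field k] [CommRing S] [IsDomain S] [Algebra k S]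
  [LinearOrderedCommGroupWithZero Γ]

namespace IsPlaceAtInfinity

/-- Two points with the same image under a tame polynomial that stay at bounded distance near
infinity coincide. -/
theorem eq_zero_of_aeval_add_eq {v : Valuation S Γ} {y δ : S} (hy : IsPlaceAtInfinity k v y)
    {H : k[X]} (hH : (H.natDegree : k) ≠ 0) (h : aeval (y + δ) H = aeval y H) (hδ : v δ ≤ 1) :
    δ = 0 := by
  by_contra hδ0
  have hd : 1 ≤ H.natDegree := Nat.one_le_iff_ne_zero.2 fun h0 => hH (by simp [h0])
  have hpos : 0 < v y := lt_trans zero_lt_one hy.one_lt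
  let c : ℕ → S := fun j => aeval y (hasseDeriv j H)
  have hc1 : v (c 1) = v y ^ (H.natDegree - 1) := by
    have hcoef : (derivative H).coeff (H.natDegree - 1) ≠ 0 := by
      rw [coeff_derivative, Nat.sub_add_cancel hd]
      have : ((H.natDegree - 1 : ℕ) : k) + 1 = H.natDegree := by
        rw [← Nat.cast_succ, Nat.succ_eq_add_one, Nat.sub_add_cancel hd]
      rw [this]
      refine mul_ne_zero (leadingCoeff_ne_zero.2 ?_) hH
      rintro rfl
      simp at hd
    have hdeg : (derivative H).natDegree = H.natDegree - 1 :=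
      le_antisymm (natDegree_derivative_le H) (le_natDegree_of_ne_zero hcoef)
    have h0 : derivative H ≠ 0 := fun h0 => hcoef (by simp [h0])
    change v (aeval y (hasseDeriv 1 H)) = _
    rw [hasseDeriv_one, hy.map_aeval h0, hdeg]
  have hcj : ∀ j, v (c j) ≤ v y ^ (H.natDegree - j) := fun j =>
    hy.map_aeval_le _ (natDegree_hasseDeriv_le _ _)
  have hsum : aeval (y + δ) H = c 0 + δ * (c 1 +
      ∑ j ∈ Finset.range (H.natDegree - 1), c (j + 2) * δ ^ (j + 1)) := by
    have h1 : aeval (y + δ) H = (taylor y (H.map (algebraMap k S))).eval δ := by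
      rw [taylor_eval, eval_map_algebraMap, add_comm]
    have h2 : ∀ j, (taylor y (H.map (algebraMap k S))).coeff j = c j := fun j => by
      have h3 : hasseDeriv j (H.map (algebraMap k S)) = (hasseDeriv j H).map (algebraMap k S) := by
        ext i
        simp [hasseDeriv_coeff]
      rw [taylor_coeff, h3, eval_map_algebraMap]
    rw [h1, eval_eq_sum_range, natDegree_taylor, natDegree_map]
    obtain ⟨d, hd'⟩ := Nat.exists_eq_add_of_le' hd
    rw [hd', Finset.sum_range_succ', Finset.sum_range_succ', Nat.add_sub_cancel]
    simp only [h2]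
    rw [mul_add, Finset.mul_sum, pow_zero, mul_one, zero_add, pow_one, add_comm, mul_comm δ (c 1),
      add_comm (∑ i ∈ _, _)]
    congr 2
    exact Finset.sum_congr rfl fun j _ => by ring
  have h0 : c 1 + ∑ j ∈ Finset.range (H.natDegree - 1), c (j + 2) * δ ^ (j + 1) = 0 := by
    rw [hsum] at h
    have h3 : c 0 = aeval y H := by simp [c]
    rw [h3, add_eq_left] at h
    exact (mul_eq_zero.1 h).resolve_left hδ0
  have hlt : v (∑ j ∈ Finset.range (H.natDegree - 1), c (j + 2) * δ ^ (j + 1)) < v (c 1) := by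
    rw [hc1]
    refine v.map_sum_lt (pow_pos hpos _).ne' fun j hj => ?_
    rw [Finset.mem_range] at hj
    rw [map_mul, map_pow]
    refine (mul_le_of_le_one_right' (pow_le_one' hδ _)).trans_lt ((hcj _).trans_lt ?_)
    exact pow_lt_pow_right₀ hy.one_lt (by omega)
  have := v.map_add_eq_of_lt_left hlt
  rw [h0, map_zero, hc1] at this
  exact (pow_pos hpos _).ne this

end IsPlaceAtInfinity

end Separation

section Nullstellensatz

theorem exists_algHom_ker_eq {k S : Type*} [Field k] [IsAlgClosed k] [CommRing S] [Algebra k S]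
    [Algebra.FiniteType k S] {f : S} (hf : ¬ IsUnit f) : ∃ φ : S →ₐ[k] k, φ f = 0 := by
  obtain ⟨M, hM, hfM⟩ := exists_max_ideal_of_mem_nonunits hf
  let := Ideal.Quotient.field M
  have hfin : Algebra.FiniteType k (S ⧸ M) := inferInstance
  have : Module.Finite k (S ⧸ M) := finite_of_finite_type_of_isJacobsonRing k (S ⧸ M)
  let e := AlgEquiv.ofBijective (Algebra.ofId k (S ⧸ M))
    (IsAlgClosed.algebraMap_bijective_of_isIntegral (k := k) (K := S ⧸ M))
  refine ⟨(e.symm : (S ⧸ M) →ₐ[k] k).comp (Ideal.Quotient.mkₐ k M), ?_⟩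
  simp [Ideal.Quotient.eq_zero_iff_mem.2 hfM]

variable {k S G Γ : Type*} [Field k] [IsAlgClosed k] [CommRing S] [IsDomain S] [Algebra k S]
  [Algebra k[X] S] [IsScalarTower k k[X] S] [FaithfulSMul k[X] S] [Module.Finite k[X] S] [Group G]
  [Finite G] [MulSemiringAction G S] [hG : IsGaloisGroup G k[X] S]
  [LinearOrderedCommGroupWithZero Γ]

include hG in
/-- A function all of whose conjugates have a pole at a place at infinity has a zero. -/
theorem IsPlaceAtInfinity.exists_algHom_apply_eq_zero {v : Valuation S Γ}
    (hv : IsPlaceAtInfinity k v (algebraMap k[X] S X)) {f : S} (hf : ∀ σ : G, 1 < v (σ • f)) :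
    ∃ φ : S →ₐ[k] k, φ f = 0 := by
  have : Algebra.FiniteType k S := .trans (S := k[X]) inferInstance inferInstance
  refine exists_algHom_ker_eq fun hu => ?_
  obtain ⟨g, hg⟩ := hu.exists_right_inv
  have hg0 : g = 0 := hv.eq_zero_of_lt_one (G := G) fun σ => by
    have h1 : v (σ • f) * v (σ • g) = 1 := by
      rw [← map_mul, ← smul_mul', hg, smul_one, map_one]
    by_contra! h
    exact absurd h1 (one_lt_mul_of_lt_of_le (hf σ) h).ne'
  simp [hg0] at hg

end Nullstellensatz

/-- A polynomial with nondegenerate critical points and pairwise distinct critical values. -/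
structure IsMorse {k : Type*} [Field k] (H : k[X]) : Prop where
  eq_of_eval_eq : ∀ y z, (derivative H).eval y = 0 → (derivative H).eval z = 0 →
    H.eval y = H.eval z → y = z
  not_cube_dvd : ∀ y, (derivative H).eval y = 0 → ¬ (X - C y) ^ 3 ∣ H - C (H.eval y)

/-- The elements `r i` together with the `r i + 1` are the roots of `H(U² + U) - T`, and they
generate an extension of `k[T]` with group `G`. -/
structure IsSplittingCover (G : Type*) {k S ι : Type*} [Fintype ι] [Field k] [CommRing S]
    [Algebra k S] [Algebra k[X] S] [Group G] [MulSemiringAction G S] (H : k[X]) (r : ι → S) :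
    Prop where
  prod_eq : ∏ i, (X - C (r i ^ 2 + r i)) = H.map (algebraMap k S) - C (algebraMap k[X] S X)
  eq_one : ∀ σ : G, (∀ i, σ • r i = r i) → σ = 1

theorem ZMod.eq_zero_or_one_of_two (ε : ZMod 2) : ε = 0 ∨ ε = 1 := by
  decide +revert

theorem exists_eq_add_cast_of_sq_add_self_eq {R : Type*} [CommRing R] [IsDomain R] [CharP R 2]
    {a b : R} (h : a ^ 2 + a = b ^ 2 + b) : ∃ ε : ZMod 2, a = b + ε.cast := by
  have h2 : (2 : R) = 0 := CharTwo.two_eq_zero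
  have : (a - b) * (a - (b + 1)) = 0 := by linear_combination h + (b ^ 2 + b - a * b - a) * h2
  rcases mul_eq_zero.1 this with h | h
  · exact ⟨0, by simpa [sub_eq_zero] using h⟩
  · exact ⟨1, by simpa [sub_eq_zero] using h⟩

theorem cast_sq_add_cast {R : Type*} [CommRing R] [CharP R 2] (ε : ZMod 2) :
    (ε.cast : R) ^ 2 + ε.cast = 0 := by
  have h2 : (2 : R) = 0 := CharTwo.two_eq_zero
  rcases ε.eq_zero_or_one_of_two with rfl | rfl
  · simp
  · simp [one_add_one_eq_two, h2]

theorem smul_zmod_cast {G R : Type*} [CommRing R] [CharP R 2] [Group G] [MulSemiringAction G R] (σ : G)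
    (ε : ZMod 2) : σ • (ε.cast : R) = ε.cast := by
  rcases ε.eq_zero_or_one_of_two with rfl | rfl <;> simp

set_option linter.unusedSectionVars false

namespace IsSplittingCover

variable {k S G ι Γ : Type*} [Fintype ι] [Field k] [CommRing S] [IsDomain S]
  [Algebra k S] [Algebra k[X] S] [Group G] [MulSemiringAction G S]
  {H : k[X]} {r : ι → S} (hr : IsSplittingCover G H r)
include hr

theorem aeval_root (i : ι) : aeval (r i ^ 2 + r i) H = algebraMap k[X] S X := by
  have := congrArg (eval (r i ^ 2 + r i)) hr.prod_eq
  rw [eval_prod, Finset.prod_eq_zero (Finset.mem_univ i) (by simp), eval_sub, eval_C,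
    eval_map_algebraMap] at this
  exact (sub_eq_zero.1 this.symm)

theorem exists_eq_of_aeval_eq {z : S} (hz : aeval z H = algebraMap k[X] S X) :
    ∃ i, z = r i ^ 2 + r i := by
  have := congrArg (eval z) hr.prod_eq
  rw [eval_prod, eval_sub, eval_C, eval_map_algebraMap, hz, sub_self, Finset.prod_eq_zero_iff]
    at this
  obtain ⟨i, -, hi⟩ := this
  exact ⟨i, by simpa [sub_eq_zero] using hi⟩

theorem map_prod_eq (φ : S →ₐ[k] k) :
    ∏ i, (X - C (φ (r i) ^ 2 + φ (r i))) = H - C (φ (algebraMap k[X] S X)) := by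
  have := congrArg (Polynomial.map (φ : S →+* k)) hr.prod_eq
  rw [Polynomial.map_prod, Polynomial.map_sub, Polynomial.map_map] at this
  have h : ((φ : S →+* k).comp (algebraMap k S)) = RingHom.id k := by
    ext
    simp
  rw [h, Polynomial.map_id] at this
  simpa using this

theorem eval_map_root (φ : S →ₐ[k] k) (i : ι) :
    H.eval (φ (r i) ^ 2 + φ (r i)) = φ (algebraMap k[X] S X) := by
  rw [← hr.aeval_root i, ← aeval_algHom_apply]
  simp

theorem exists_smul_eq [CharP S 2] [IsScalarTower k k[X] S] [hG : IsGaloisGroup G k[X] S] (σ : G) (i : ι) :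
    ∃ (j : ι) (ε : ZMod 2), σ • r i = r j + ε.cast := by
  have := hG.commutes
  obtain ⟨j, hj⟩ := hr.exists_eq_of_aeval_eq (z := (σ • r i) ^ 2 + σ • r i) (by
    have h1 : (σ • r i) ^ 2 + σ • r i =
        MulSemiringAction.toAlgHom k[X] S σ (r i ^ 2 + r i) := by simp
    have h2 := aeval_algHom_apply ((MulSemiringAction.toAlgHom k[X] S σ).restrictScalars k)
      (r i ^ 2 + r i) H
    rw [hr.aeval_root i] at h2
    rw [h1]
    refine h2.trans ?_
    exact smul_algebraMap _ _)
  obtain ⟨ε, hε⟩ := exists_eq_add_cast_of_sq_add_self_eq hj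
  exact ⟨j, ε, hε⟩

variable [LinearOrderedCommGroupWithZero Γ] {v : Valuation S Γ}
  (hv : IsPlaceAtInfinity k v (algebraMap k[X] S X))
include hv

theorem isPlaceAtInfinity_root (i : ι) : IsPlaceAtInfinity k v (r i ^ 2 + r i) where
  map_algebraMap_le := hv.map_algebraMap_le
  one_lt := by
    by_contra! h
    refine hv.one_lt.not_ge ?_
    rw [← hr.aeval_root i, aeval_eq_sum_range]
    refine v.map_sum_le fun j _ => ?_
    rw [Algebra.smul_def, map_mul, map_pow]
    exact mul_le_one' (hv.map_algebraMap_le _) (pow_le_one' h _)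

variable (hd : (H.natDegree : k) ≠ 0)
include hd

theorem sq_add_self_injective : Function.Injective fun i => r i ^ 2 + r i := by
  classical
  intro i j hij
  by_contra hne
  have h0 : derivative H ≠ 0 := by
    intro h
    have h1 : (derivative H).coeff (H.natDegree - 1) = 0 := by rw [h, coeff_zero]
    have hpos : 1 ≤ H.natDegree := Nat.one_le_iff_ne_zero.2 fun h0 => hd (by simp [h0])
    rw [coeff_derivative, ← Nat.cast_succ, Nat.succ_eq_add_one, Nat.sub_add_cancel hpos] at h1
    refine hd ((mul_eq_zero.1 h1).resolve_left fun h2 => ?_)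
    rw [coeff_natDegree, leadingCoeff_eq_zero] at h2
    simp [h2] at hpos
  have hdvd : (X - C (r i ^ 2 + r i)) ^ 2 ∣
      H.map (algebraMap k S) - C (algebraMap k[X] S X) := by
    rw [← hr.prod_eq, ← Finset.mul_prod_erase _ _ (Finset.mem_univ i),
      ← Finset.mul_prod_erase _ _ (Finset.mem_erase.2 ⟨Ne.symm hne, Finset.mem_univ j⟩), pow_two]
    simp only at hij
    rw [← hij, ← mul_assoc]
    exact dvd_mul_right _ _
  obtain ⟨g, hg⟩ := hdvd
  have := congrArg (fun p => eval (r i ^ 2 + r i) (derivative p)) hg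
  simp only [derivative_mul, derivative_pow, derivative_sub, derivative_map, derivative_C, sub_zero,
    eval_add, eval_mul, eval_pow, eval_sub, eval_X, eval_C, sub_self, eval_map_algebraMap] at this
  simp only [Nat.add_one_sub_one, pow_one, mul_zero, zero_mul, ne_eq, OfNat.ofNat_ne_zero,
    not_false_eq_true, zero_pow, add_zero] at this
  have h1 := (hr.isPlaceAtInfinity_root hv i).one_le_map_aeval h0
  rw [this, map_zero] at h1
  exact absurd h1 (by simp)

variable [CharP k 2]

theorem one_lt_map_add [CharP S 2] {i j : ι} (hij : i ≠ j) (ε : ZMod 2) :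
    1 < v (r i + r j + ε.cast) := by
  by_contra! h
  have hε : v (ε.cast : S) ≤ 1 := by
    rcases ε.eq_zero_or_one_of_two with rfl | rfl <;> simp
  have h2 : (2 : S) = 0 := CharTwo.two_eq_zero
  have hδ : (r i + r j) ^ 2 + (r i + r j) =
      (r i + r j + ε.cast) * (r i + r j + ε.cast + 1) := by
    linear_combination -(cast_sq_add_cast (R := S) ε) - (r i + r j) * ε.cast * h2
  have h0 := (hr.isPlaceAtInfinity_root hv i).eq_zero_of_aeval_add_eq hd
    (δ := (r i + r j) ^ 2 + (r i + r j)) (by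
      rw [hr.aeval_root i, ← hr.aeval_root j]
      congr 1
      congr 1
      linear_combination (r i ^ 2 + r i + r i * r j) * h2) (by
      rw [hδ, map_mul]
      exact mul_le_one' h ((v.map_add_le h (by simp))))
  refine hij (hr.sq_add_self_injective hv hd ?_)
  simp only
  linear_combination h0 - (r i * r j + r j ^ 2 + r j) * h2

end IsSplittingCover

section Monodromy

variable {k S G ι Γ : Type*} [Fintype ι] [Field k] [IsAlgClosed k] [CharP k 2] [CommRing S]
  [IsDedekindDomain S] [CharP S 2] [Algebra k S] [Algebra k[X] S] [IsScalarTower k k[X] S]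
  [FaithfulSMul k[X] S] [Module.Finite k[X] S] [Group G] [Finite G] [MulSemiringAction G S]
  [hG : IsGaloisGroup G k[X] S] [LinearOrderedCommGroupWithZero Γ] {H : k[X]} {r : ι → S}

namespace IsSplittingCover

omit [CharP k 2] [CharP S 2] [FaithfulSMul k[X] S] [Module.Finite k[X] S] [Finite G] hG
  [IsScalarTower k k[X] S] [IsAlgClosed k] in
theorem derivative_eval_eq_zero [DecidableEq ι] (hr : IsSplittingCover G H r) (φ : S →ₐ[k] k)
    {i j : ι} (hij : i ≠ j) (h : φ (r i) ^ 2 + φ (r i) = φ (r j) ^ 2 + φ (r j)) :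
    (derivative H).eval (φ (r i) ^ 2 + φ (r i)) = 0 ∧
      (X - C (φ (r i) ^ 2 + φ (r i))) ^ 2 ∣ H - C (φ (algebraMap k[X] S X)) := by
  have hdvd : (X - C (φ (r i) ^ 2 + φ (r i))) ^ 2 ∣ H - C (φ (algebraMap k[X] S X)) := by
    rw [← hr.map_prod_eq, ← Finset.mul_prod_erase _ _ (Finset.mem_univ i),
      ← Finset.mul_prod_erase _ _ (Finset.mem_erase.2 ⟨Ne.symm hij, Finset.mem_univ j⟩), pow_two,
      ← h, ← mul_assoc]
    exact dvd_mul_right _ _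
  refine ⟨?_, hdvd⟩
  obtain ⟨g, hg⟩ := hdvd
  generalize φ (r i) ^ 2 + φ (r i) = e at hg ⊢
  have := congrArg (fun p => eval e (derivative p)) hg
  simpa [derivative_pow] using this

/-- The inertia groups of an Artin-Schreier lift of a Morse polynomial contain the expected double
transpositions. -/
theorem exists_smul_swap [DecidableEq ι] (hr : IsSplittingCover G H r) {v : Valuation S Γ}
    (hv : IsPlaceAtInfinity k v (algebraMap k[X] S X)) (hd : (H.natDegree : k) ≠ 0)
    (hH : IsMorse H) {i j : ι} (hij : i ≠ j) (ε : ZMod 2) :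
    ∃ τ : G, τ • r i = r j + ε.cast ∧ τ • r j = r i + ε.cast ∧
      ∀ l, l ≠ i → l ≠ j → τ • r l = r l := by
  have h2 : (2 : k) = 0 := CharTwo.two_eq_zero
  have hcast : ∀ (φ : S →ₐ[k] k) (ε : ZMod 2), φ ε.cast = ε.cast := by
    intro φ ε
    rcases ε.eq_zero_or_one_of_two with rfl | rfl <;> simp
  have hinj := hr.sq_add_self_injective hv hd
  obtain ⟨φ, hφ⟩ := hv.exists_algHom_apply_eq_zero (G := G) (f := r i + r j + ε.cast) (by
    intro σ
    obtain ⟨i', ε₁, hi⟩ := hr.exists_smul_eq σ i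
    obtain ⟨j', ε₂, hj⟩ := hr.exists_smul_eq σ j
    have hne : i' ≠ j' := by
      rintro rfl
      refine hij (hinj ?_)
      refine (smul_left_cancel_iff σ).1 ?_
      simp only [smul_add, smul_pow', hi, hj]
      have h2 : (2 : S) = 0 := CharTwo.two_eq_zero
      linear_combination cast_sq_add_cast (R := S) ε₁ - cast_sq_add_cast (R := S) ε₂ +
        r i' * (ε₁.cast - ε₂.cast) * h2
    have := hr.one_lt_map_add hv hd hne (ε₁ + ε₂ + ε)
    rw [ZMod.cast_add', ZMod.cast_add'] at this
    rw [smul_add, smul_add, smul_zmod_cast, hi, hj]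
    convert this using 2
    ring)
  rw [map_add, map_add, hcast] at hφ
  have hφ' : φ (r i) = φ (r j) + ε.cast := by linear_combination hφ - (φ (r j) + ε.cast) * h2
  let η : ι → k := fun l => φ (r l) ^ 2 + φ (r l)
  have hηij : η i = η j := by
    simp only [η, hφ']
    linear_combination cast_sq_add_cast (R := k) ε + φ (r j) * ε.cast * h2
  have hηeval : ∀ l, H.eval (η l) = φ (algebraMap k[X] S X) := hr.eval_map_root φ
  have hcrit := hr.derivative_eval_eq_zero φ hij hηij
  have honly : ∀ l, l ≠ i → l ≠ j → η l ≠ η i := by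
    intro l hli hlj hl
    refine hH.not_cube_dvd _ hcrit.1 ?_
    have h3 : (X - C (η i)) ^ 3 ∣ H - C (φ (algebraMap k[X] S X)) := by
      rw [← hr.map_prod_eq, ← Finset.mul_prod_erase _ _ (Finset.mem_univ i),
        ← Finset.mul_prod_erase _ _ (Finset.mem_erase.2 ⟨Ne.symm hij, Finset.mem_univ j⟩),
        ← Finset.mul_prod_erase _ _ (Finset.mem_erase.2
          ⟨hlj, Finset.mem_erase.2 ⟨hli, Finset.mem_univ l⟩⟩)]
      change _ ∣ (X - C (η i)) * ((X - C (η j)) * ((X - C (η l)) * _))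
      rw [hl, ← hηij]
      rw [pow_succ, pow_two, mul_assoc]
      exact mul_dvd_mul_left _ (mul_dvd_mul_left _ (dvd_mul_right _ _))
    rwa [← hηeval i] at h3
  have hpair : ∀ l l', l ≠ l' → η l = η l' → η l = η i := fun l l' hll h =>
    hH.eq_of_eval_eq _ _ (hr.derivative_eval_eq_zero φ hll h).1 hcrit.1
      (by rw [hηeval, hηeval])
  obtain ⟨τ, hτ1, hτ⟩ := exists_ne_one_forall_map_smul_eq (G := G) φ (by
    obtain ⟨g, hg⟩ := hcrit.2
    have h3 := congrArg (aeval (r i ^ 2 + r i)) hg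
    rw [map_sub, hr.aeval_root, aeval_C, map_mul, map_pow, map_sub, aeval_X, aeval_C] at h3
    rw [h3]
    refine Ideal.mul_mem_right _ _ (Ideal.pow_mem_pow ?_ 2)
    rw [RingHom.mem_ker]
    simp)
  have hact : ∀ l, ∃ (l' : ι) (ε' : ZMod 2), τ • r l = r l' + ε'.cast ∧ φ (r l) = φ (r l') + ε'.cast ∧
      η l = η l' := by
    intro l
    obtain ⟨l', ε', h⟩ := hr.exists_smul_eq τ l
    have h1 : φ (r l) = φ (r l') + ε'.cast := by rw [← hτ, h, map_add, hcast]
    refine ⟨l', ε', h, h1, ?_⟩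
    simp only [η, h1]
    linear_combination cast_sq_add_cast (R := k) ε' + φ (r l') * ε'.cast * h2
  have hcast0 : ∀ (a : k) (ε₁ ε₂ : ZMod 2), a + ε₁.cast = a + ε₂.cast → ε₁ = ε₂ := by
    intro a ε₁ ε₂ h
    have h := add_left_cancel h
    rcases ε₁.eq_zero_or_one_of_two with rfl | rfl <;>
    rcases ε₂.eq_zero_or_one_of_two with rfl | rfl <;> simp_all
  have hfix : ∀ l, l ≠ i → l ≠ j → τ • r l = r l := by
    intro l hli hlj
    obtain ⟨l', ε', h, h1, h3⟩ := hact l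
    by_cases hl : l = l'
    · subst hl
      have : ε' = 0 := hcast0 (φ (r l)) _ _ (by rw [← h1]; simp)
      rw [h, this]
      simp
    · exact absurd (hpair l l' hl h3) (honly l hli hlj)
  have hmove : ∀ a b, a ≠ b → η a = η i → φ (r a) = φ (r b) + ε.cast →
      (∀ l, η l = η i → l = a ∨ l = b) → τ • r a = r a ∨ τ • r a = r b + ε.cast := by
    intro a b hab ha hφab hab'
    obtain ⟨l', ε', h, h1, h3⟩ := hact a
    rcases hab' l' (by rw [← h3, ha]) with rfl | rfl
    · left
      have : ε' = 0 := hcast0 (φ (r l')) _ _ (by rw [← h1]; simp)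
      rw [h, this]
      simp
    · right
      rw [h, hcast0 (φ (r l')) ε' ε (by rw [← h1, hφab])]
  have hφ'' : φ (r j) = φ (r i) + ε.cast := by linear_combination hφ - (φ (r i) + ε.cast) * h2
  have hset : ∀ l, η l = η i → l = i ∨ l = j := by
    intro l hl
    by_contra! h
    exact honly l h.1 h.2 hl
  have hsmulη : ∀ a b, τ • r a = r b + ε.cast → τ • r b = r b → a = b := by
    intro a b h1 h3
    refine hinj ((smul_left_cancel_iff τ).1 ?_)
    simp only [smul_add, smul_pow', h1, h3]
    have h2 : (2 : S) = 0 := CharTwo.two_eq_zero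
    linear_combination cast_sq_add_cast (R := S) ε + r b * ε.cast * h2
  refine ⟨τ, ?_, ?_, hfix⟩
  · rcases hmove i j hij rfl hφ' hset with h | h
    · exfalso
      rcases hmove j i (Ne.symm hij) hηij.symm hφ'' (fun l hl => (hset l hl).symm) with h' | h'
      · refine hτ1 (hr.eq_one τ fun l => ?_)
        by_cases hli : l = i
        · rw [hli, h]
        by_cases hlj : l = j
        · rw [hlj, h']
        exact hfix l hli hlj
      · exact hij (hsmulη j i h' h).symm
    · exact h
  · rcases hmove j i (Ne.symm hij) hηij.symm hφ'' (fun l hl => (hset l hl).symm) with h' | h'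
    · exfalso
      rcases hmove i j hij rfl hφ' hset with h | h
      · refine hτ1 (hr.eq_one τ fun l => ?_)
        by_cases hli : l = i
        · rw [hli, h]
        by_cases hlj : l = j
        · rw [hlj, h']
        exact hfix l hli hlj
      · exact hij (hsmulη i j h h')
    · exact h'

/-- The monodromy group contains every signed permutation with an even number of sign changes. -/
theorem exists_smul_eq_of_sum_eq_zero (hr : IsSplittingCover G H r) {v : Valuation S Γ}
    (hv : IsPlaceAtInfinity k v (algebraMap k[X] S X)) (hd : (H.natDegree : k) ≠ 0)
    (hH : IsMorse H) (ρ : Equiv.Perm ι) (ε : ι → ZMod 2) (hε : ∑ i, ε i = 0) :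
    ∃ σ : G, ∀ i, σ • r i = r (ρ i) + (ε i).cast := by
  classical
  have hperm : ∀ ρ : Equiv.Perm ι, ∃ σ : G, ∀ i, σ • r i = r (ρ i) := by
    intro ρ
    induction ρ using Equiv.Perm.swap_induction_on with
    | one => exact ⟨1, fun i => by simp⟩
    | swap_mul f x y hxy ih =>
      obtain ⟨σ, hσ⟩ := ih
      obtain ⟨τ, hx, hy, hτ⟩ := hr.exists_smul_swap hv hd hH hxy 0
      refine ⟨τ * σ, fun i => ?_⟩
      rw [mul_smul, hσ, Equiv.Perm.mul_apply]
      by_cases h1 : f i = x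
      · rw [h1, hx, Equiv.swap_apply_left]
        simp
      by_cases h2 : f i = y
      · rw [h2, hy, Equiv.swap_apply_right]
        simp
      rw [hτ _ h1 h2, Equiv.swap_apply_of_ne_of_ne h1 h2]
  have hflip : ∀ i j, i ≠ j → ∃ σ : G, ∀ l,
      σ • r l = r l + ((Pi.single i 1 + Pi.single j 1 : ι → ZMod 2) l).cast := by
    intro i j hij
    obtain ⟨τ₀, hi₀, hj₀, h₀⟩ := hr.exists_smul_swap hv hd hH hij 0
    obtain ⟨τ₁, hi₁, hj₁, h₁⟩ := hr.exists_smul_swap hv hd hH hij 1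
    refine ⟨τ₁ * τ₀, fun l => ?_⟩
    rw [mul_smul]
    by_cases hi : l = i
    · subst hi
      simp [hi₀, hj₁, hij]
    by_cases hj : l = j
    · subst hj
      simp [hj₀, hi₁, Ne.symm hij]
    simp [h₀ l hi hj, h₁ l hi hj, hi, hj]
  have hsum : ∀ (i₀ : ι) (s : Finset ι), i₀ ∉ s → ∃ σ : G, ∀ l, σ • r l = r l +
      ((∑ i ∈ s, ε i • (Pi.single i 1 + Pi.single i₀ 1 : ι → ZMod 2)) l).cast := by
    intro i₀ s
    induction s using Finset.induction_on with
    | empty => exact fun _ => ⟨1, fun l => by simp⟩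
    | insert a s ha ih =>
      intro hi₀
      obtain ⟨σ, hσ⟩ := ih fun h => hi₀ (Finset.mem_insert_of_mem h)
      rw [Finset.sum_insert ha]
      rcases (ε a).eq_zero_or_one_of_two with h | h
      · exact ⟨σ, fun l => by rw [hσ, h, zero_smul, zero_add]⟩
      · obtain ⟨τ, hτ⟩ := hflip a i₀ fun h => hi₀ (h ▸ Finset.mem_insert_self a s)
        refine ⟨τ * σ, fun l => ?_⟩
        rw [mul_smul, hσ, smul_add, smul_zmod_cast, hτ, h, one_smul, Pi.add_apply _ (∑ i ∈ s, _),
          ZMod.cast_add', add_assoc]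
  obtain ⟨σ, hσ⟩ : ∃ σ : G, ∀ i, σ • r i = r i + (ε i).cast := by
    rcases isEmpty_or_nonempty ι with h | ⟨⟨i₀⟩⟩
    · exact ⟨1, fun i => h.elim i⟩
    obtain ⟨σ, hσ⟩ := hsum i₀ (Finset.univ.erase i₀) (Finset.notMem_erase _ _)
    refine ⟨σ, fun i => ?_⟩
    rw [hσ]
    congr 2
    rw [Finset.sum_apply]
    by_cases hi : i = i₀
    · subst hi
      have : ∀ j ∈ Finset.univ.erase i,
          (ε j • (Pi.single j 1 + Pi.single i 1 : ι → ZMod 2)) i = ε j := by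
        intro j hj
        have := Finset.ne_of_mem_erase hj
        simp [Ne.symm this]
      rw [Finset.sum_congr rfl this]
      rw [← Finset.add_sum_erase _ _ (Finset.mem_univ i)] at hε
      have h2 : (2 : ZMod 2) = 0 := rfl
      linear_combination hε - ε i * h2
    · rw [Finset.sum_eq_single i]
      · simp [hi]
      · intro j _ hj
        simp [hi, Ne.symm hj]
      · intro h
        simp [hi] at h
  obtain ⟨τ, hτ⟩ := hperm ρ
  exact ⟨τ * σ, fun i => by rw [mul_smul, hσ, smul_add, smul_zmod_cast, hτ]⟩

end IsSplittingCover

end Monodromy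

section Counting

variable {k S G ι Γ : Type*} [Fintype ι] [Field k] [IsAlgClosed k] [CharP k 2] [CommRing S]
  [IsDedekindDomain S] [CharP S 2] [Algebra k S] [Algebra k[X] S] [IsScalarTower k k[X] S]
  [FaithfulSMul k[X] S] [Module.Finite k[X] S] [Group G] [Finite G] [MulSemiringAction G S]
  [hG : IsGaloisGroup G k[X] S] [LinearOrderedCommGroupWithZero Γ] {H : k[X]} {r : ι → S}

namespace IsSplittingCover

omit [IsAlgClosed k] [CharP k 2] [CharP S 2] [IsScalarTower k k[X] S] [FaithfulSMul k[X] S]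
  [Module.Finite k[X] S] [Finite G] hG in
theorem nextCoeff_eq (hr : IsSplittingCover G H r) (hdeg : 2 ≤ H.natDegree) (φ : S →ₐ[k] k) :
    H.nextCoeff = -∑ i, (φ (r i) ^ 2 + φ (r i)) := by
  have h := congrArg nextCoeff (hr.map_prod_eq φ)
  rw [prod_X_sub_C_nextCoeff] at h
  rw [h, nextCoeff_of_natDegree_pos (by omega), nextCoeff_of_natDegree_pos (by
    rw [natDegree_sub_C]; omega), natDegree_sub_C, coeff_sub, coeff_C_of_ne_zero (by omega), sub_zero]

/-- At a rational point of the base the Frobenius is given by an element of the monodromy group,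
as soon as the Artin-Schreier sum of the roots is rational. -/
theorem exists_smul_eq_pow (hr : IsSplittingCover G H r) {v : Valuation S Γ}
    (hv : IsPlaceAtInfinity k v (algebraMap k[X] S X)) (hd : (H.natDegree : k) ≠ 0)
    (hdeg : 2 ≤ H.natDegree) (hH : IsMorse H) (n : ℕ)
    (hHq : ∀ i, H.coeff i ^ 2 ^ n = H.coeff i) {w : k} (hwq : w ^ 2 ^ n = w)
    (hw : w ^ 2 + w = H.nextCoeff) (φ : S →ₐ[k] k)
    (ht : φ (algebraMap k[X] S X) ^ 2 ^ n = φ (algebraMap k[X] S X))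
    (hinj : Function.Injective fun i => φ (r i) ^ 2 + φ (r i)) :
    ∃ σ : G, ∀ i, φ (r i) ^ 2 ^ n = φ (σ • r i) := by
  have := ExpChar.prime (R := k) Nat.prime_two
  let F := iterateFrobenius k 2 n
  have hF : ∀ x, x ^ 2 ^ n = F x := fun x => rfl
  have hcast : ∀ ε : ZMod 2, φ ε.cast = ε.cast := by
    intro ε
    rcases ε.eq_zero_or_one_of_two with rfl | rfl <;> simp
  simp only [hF] at *
  have hHF : H.map F = H := by
    ext i
    rw [coeff_map, hHq]
  have hperm : ∀ i, ∃ j, F (φ (r i) ^ 2 + φ (r i)) = φ (r j) ^ 2 + φ (r j) := by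
    intro i
    have h1 : H.eval (F (φ (r i) ^ 2 + φ (r i))) = φ (algebraMap k[X] S X) := by
      conv_lhs => rw [← hHF]
      rw [eval_map_apply, hr.eval_map_root, ht]
    have h2 := congrArg (eval (F (φ (r i) ^ 2 + φ (r i)))) (hr.map_prod_eq φ)
    rw [eval_sub, h1, eval_C, sub_self, eval_prod, Finset.prod_eq_zero_iff] at h2
    obtain ⟨j, -, hj⟩ := h2
    exact ⟨j, by simpa [sub_eq_zero] using hj⟩
  choose ρ hρ using hperm
  have hρinj : Function.Injective ρ := by
    intro i j hij
    refine hinj (F.injective ?_)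
    simp only [hρ, hij]
  have hε : ∀ i, ∃ ε : ZMod 2, F (φ (r i)) = φ (r (ρ i)) + ε.cast := fun i =>
    exists_eq_add_cast_of_sq_add_self_eq (by rw [← hρ, map_add, map_pow])
  choose ε hε using hε
  let ρ' : Equiv.Perm ι := Equiv.ofBijective ρ (Finite.injective_iff_bijective.1 hρinj)
  have hsum : ∑ i, ε i = 0 := by
    have h2 : (2 : k) = 0 := CharTwo.two_eq_zero
    have h1 : F (∑ i, φ (r i)) = ∑ i, φ (r i) := by
      have h3 : (∑ i, φ (r i)) ^ 2 + ∑ i, φ (r i) = w ^ 2 + w := by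
        rw [hw, hr.nextCoeff_eq hdeg φ, Finset.sum_add_distrib, sum_pow_char]
        linear_combination (∑ i, φ (r i) ^ 2 + ∑ i, φ (r i)) * h2
      obtain ⟨δ, hδ⟩ := exists_eq_add_cast_of_sq_add_self_eq h3
      rw [hδ, map_add, hwq]
      rcases δ.eq_zero_or_one_of_two with rfl | rfl <;> simp
    have h4 : ∑ i, φ (r (ρ i)) = ∑ i, φ (r i) := Equiv.sum_comp ρ' fun i => φ (r i)
    rw [map_sum, Finset.sum_congr rfl fun i _ => hε i, Finset.sum_add_distrib, h4, add_eq_left]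
      at h1
    have h5 : ((∑ i, ε i : ZMod 2).cast : k) = 0 := by
      rw [← h1]
      exact map_sum (ZMod.castHom (dvd_refl 2) k) _ _
    rcases (∑ i, ε i).eq_zero_or_one_of_two with h | h
    · exact h
    · rw [h] at h5
      simp at h5
  obtain ⟨σ, hσ⟩ := hr.exists_smul_eq_of_sum_eq_zero hv hd hH ρ' ε hsum
  refine ⟨σ, fun i => ?_⟩
  rw [hσ, map_add, hcast, hε]
  rfl

omit [IsAlgClosed k] [FaithfulSMul k[X] S] [Module.Finite k[X] S] [Finite G] hG
  [IsScalarTower k k[X] S] [CharP k 2] in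
theorem map_root_add_cast_le (hr : IsSplittingCover G H r) {v : Valuation S Γ}
    (hv : IsPlaceAtInfinity k v (algebraMap k[X] S X)) (hd : (H.natDegree : k) ≠ 0)
    (i : ι) (ε : ZMod 2) : v (r i + ε.cast) ≤ v (algebraMap k[X] S X) := by
  have hε : v (ε.cast : S) ≤ 1 := by
    rcases ε.eq_zero_or_one_of_two with rfl | rfl <;> simp
  refine v.map_add_le ?_ (hε.trans hv.one_lt.le)
  by_contra! h
  have h1 : 1 < v (r i) := hv.one_lt.trans h
  have hH0 : H ≠ 0 := by
    rintro rfl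
    simp at hd
  have hpos : H.natDegree ≠ 0 := fun h0 => hd (by simp [h0])
  have h2 := (hr.isPlaceAtInfinity_root hv i).map_aeval hH0
  have h3 : v (r i ^ 2 + r i) = v (r i) ^ 2 := by
    rw [v.map_add_eq_of_lt_left, map_pow]
    rw [map_pow]
    exact lt_self_pow₀ h1 (by norm_num)
  rw [hr.aeval_root, h3, ← pow_mul] at h2
  rw [h2] at h
  exact h.not_ge (le_self_pow₀ h1.le (by positivity))

/-- An effective Chebotarev density theorem for the identity class. -/
theorem exists_forall_pow_eq (hr : IsSplittingCover G H r) {v : Valuation S Γ}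
    (hv : IsPlaceAtInfinity k v (algebraMap k[X] S X)) (hd : (H.natDegree : k) ≠ 0)
    (hdeg : 2 ≤ H.natDegree) (hH : IsMorse H) {n : ℕ}
    (hHq : ∀ i, H.coeff i ^ 2 ^ n = H.coeff i) {w : k} (hwq : w ^ 2 ^ n = w)
    (hw : w ^ 2 + w = H.nextCoeff) {J : Type*} [Fintype J]
    (hcard : Fintype.card J = Module.finrank k[X] S) {b : J → S} (hb : LinearIndependent k[X] b)
    {C : ℕ} (hbr : ∀ j, ∃ e : ι → ℕ, ∑ i, e i ≤ C ∧ b j = ∏ i, r i ^ e i)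
    {B : ℕ} (A : Finset k) (hA : 2 ^ n ≤ A.card + B) (hAq : ∀ t ∈ A, t ^ 2 ^ n = t)
    (hAcrit : ∀ t ∈ A, ∀ y, (derivative H).eval y = 0 → H.eval y ≠ t)
    {D μ ν l m : ℕ} (hD : D = Fintype.card J) (hn : ν + μ = n) (hQ : D * (l + C + C) < 2 ^ ν)
    (hdim : D * ((l + C) * 2 ^ μ + m + C + 1) < D * (l + 1) * (D * (m + 1)))
    (hbound : (D - 1) * (D * (l + C + 2 ^ ν * (m + C) + C)) + D * B < D * 2 ^ n) :
    ∃ φ : S →ₐ[k] k, φ (algebraMap k[X] S X) ∈ A ∧ ∀ i, φ (r i) ^ 2 ^ n = φ (r i) := by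
  classical
  subst hD
  have := Fintype.ofFinite G
  have := hG.commutes
  have := Fact.mk Nat.prime_two
  by_contra! hcon
  have hGcard : Fintype.card G = Fintype.card J := by
    rw [hcard, ← Nat.card_eq_fintype_card, IsGaloisGroup.card_eq_finrank' G k[X] S]
  have hsec : ∀ i, r i ∈ hv.sections G 1 := by
    intro i σ
    obtain ⟨j, ε, h⟩ := hr.exists_smul_eq σ i
    rw [h, pow_one]
    exact hr.map_root_add_cast_le hv hd j ε
  have hbC : ∀ (τ : G) (j : J), τ • b j ∈ hv.sections G C := by
    intro τ j σ
    obtain ⟨e, he, hj⟩ := hbr j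
    rw [smul_smul, hj, Finset.smul_prod', map_prod]
    calc _ ≤ ∏ i, v (algebraMap k[X] S X) ^ e i := by
          refine Finset.prod_le_prod' fun i _ => ?_
          rw [smul_pow', map_pow]
          refine pow_le_pow_left₀ zero_le ?_ _
          simpa using hsec i (σ * τ)
      _ ≤ _ := by
          rw [Finset.prod_pow_eq_pow_sum]
          exact pow_le_pow_right₀ hv.one_lt.le he
  have hpt : ∀ t : k, ∃ φ : S →ₐ[k] k, φ (algebraMap k[X] S X) = t := by
    intro t
    obtain ⟨φ, hφ⟩ := hv.exists_algHom_apply_eq_zero (G := G)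
      (f := algebraMap k[X] S X - algebraMap k S t) fun σ => by
        rw [smul_sub, smul_algebraMap, IsGaloisGroup.smul_algebraMap_const,
          v.map_sub_eq_of_lt_left ((hv.map_algebraMap_le t).trans_lt hv.one_lt)]
        exact hv.one_lt
    exact ⟨φ, by simpa [sub_eq_zero] using hφ⟩
  choose φ hφ using hpt
  let ψ : k × G → S →ₐ[k] k := fun x =>
    (φ x.1).comp ((MulSemiringAction.toAlgHom k[X] S x.2).restrictScalars k)
  have hψ : ∀ x s, ψ x s = φ x.1 (x.2 • s) := fun x s => rfl
  have hψT : ∀ x, ψ x (algebraMap k[X] S X) = x.1 := fun x => by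
    rw [hψ, smul_algebraMap, hφ]
  have hsimple : ∀ θ : S →ₐ[k] k, θ (algebraMap k[X] S X) ∈ A →
      Function.Injective fun i => θ (r i) ^ 2 + θ (r i) := by
    intro θ hθ i j hij
    by_contra hne
    exact hAcrit _ hθ _ (hr.derivative_eval_eq_zero θ hne hij).1 (hr.eval_map_root θ i)
  let Ψ : Finset (S →ₐ[k] k) := (A ×ˢ Finset.univ).image ψ
  have hΨA : ∀ θ ∈ Ψ, θ (algebraMap k[X] S X) ∈ A := by
    intro θ hθ
    obtain ⟨x, hx, rfl⟩ := Finset.mem_image.1 hθ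
    rw [hψT]
    exact (Finset.mem_product.1 hx).1
  have hΨcard : Ψ.card = A.card * Fintype.card J := by
    rw [Finset.card_image_of_injOn, Finset.card_product, Finset.card_univ, hGcard]
    rintro ⟨t, γ⟩ hx ⟨t', γ'⟩ - h
    have ht : t = t' := (hψT (t, γ)).symm.trans (by rw [h]; exact hψT (t', γ'))
    subst ht
    have htA : φ t (algebraMap k[X] S X) ∈ A := by
      rw [hφ]
      exact (Finset.mem_product.1 hx).1
    refine Prod.ext rfl ?_
    rw [← inv_mul_eq_one (a := γ)]
    refine hr.eq_one _ fun i => ?_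
    rw [mul_smul, inv_smul_eq_iff]
    obtain ⟨j, ε, h1⟩ := hr.exists_smul_eq γ i
    obtain ⟨j', ε', h2⟩ := hr.exists_smul_eq γ' i
    have h3 : φ t (γ • r i) = φ t (γ' • r i) := DFunLike.congr_fun h (r i)
    have hsq : ∀ (σ : G) (j : ι) (ε : ZMod 2), σ • r i = r j + ε.cast →
        φ t (σ • r i) ^ 2 + φ t (σ • r i) = φ t (r j) ^ 2 + φ t (r j) := by
      intro σ j ε h
      have h2 : (2 : S) = 0 := CharTwo.two_eq_zero
      rw [h, ← map_pow, ← map_add, ← map_pow, ← map_add]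
      congr 1
      linear_combination cast_sq_add_cast (R := S) ε + r j * ε.cast * h2
    have hj : j = j' := hsimple _ htA (by
      simp only
      rw [← hsq γ j ε h1, h3, hsq γ' j' ε' h2])
    subst hj
    rw [h1, h2] at h3 ⊢
    rcases ε.eq_zero_or_one_of_two with rfl | rfl <;>
    rcases ε'.eq_zero_or_one_of_two with rfl | rfl <;> simp_all
  let Φ : G → Finset (S →ₐ[k] k) := fun σ =>
    Ψ.filter fun θ => ∀ i, θ (r i) ^ 2 ^ n = θ (σ • r i)
  have hcover : Ψ ⊆ (Finset.univ.erase (1 : G)).biUnion Φ := by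
    intro θ hθ
    have hθA := hΨA θ hθ
    obtain ⟨σ, hσ⟩ := hr.exists_smul_eq_pow (G := G) hv hd hdeg hH n hHq hwq hw θ
      (hAq _ hθA) (hsimple θ hθA)
    refine Finset.mem_biUnion.2 ⟨σ, Finset.mem_erase.2 ⟨?_, Finset.mem_univ _⟩,
      Finset.mem_filter.2 ⟨hθ, hσ⟩⟩
    rintro rfl
    obtain ⟨i, hi⟩ := hcon θ hθA
    exact hi (by simpa using hσ i)
  obtain ⟨ord, hord, -⟩ := exists_isPointOrder
    (not_isField_of_isIntegral_polynomial (k := k) (S := S)) (φ 0)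
  have hstep : ∀ σ, (Φ σ).card ≤ Fintype.card J * (l + C + 2 ^ ν * (m + C) + C) := by
    intro σ
    have h1 : ∀ j, b j ∈ hv.sections G C := fun j => by simpa using hbC 1 j
    refine (hv.filtration (G := G) hcard hb h1).card_frobenius_points_le hord 2
      (fun j => σ • b j) (hbC σ) hQ hdim (Φ σ) (fun θ hθ j => ?_) (fun θ hθ => ?_)
    · obtain ⟨e, -, hj⟩ := hbr j
      rw [hj, ← pow_add, hn, Finset.smul_prod', map_prod, map_prod, ← Finset.prod_pow]
      refine Finset.prod_congr rfl fun i _ => ?_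
      rw [smul_pow', map_pow, map_pow, ← (Finset.mem_filter.1 hθ).2 i, ← pow_mul, ← pow_mul,
        mul_comm]
    · rw [← pow_add, hn]
      exact hAq _ (hΨA θ (Finset.mem_filter.1 hθ).1)
  have htotal : A.card * Fintype.card J ≤
      (Fintype.card J - 1) * (Fintype.card J * (l + C + 2 ^ ν * (m + C) + C)) := by
    rw [← hΨcard]
    refine (Finset.card_le_card hcover).trans (Finset.card_biUnion_le.trans ?_)
    refine (Finset.sum_le_card_nsmul _ _ _ fun σ _ => hstep σ).trans ?_
    rw [Finset.card_erase_of_mem (Finset.mem_univ _), Finset.card_univ, hGcard, smul_eq_mul]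
  have := Nat.mul_le_mul_left (Fintype.card J) hA
  rw [mul_add, mul_comm _ A.card] at this
  omega

end IsSplittingCover

end Counting

section Monomials

variable {F K ι : Type*} [Field F] [Field K] [Algebra F K] [Fintype ι]

/-- The span of the monomials of degree at most `C` in the elements `r i`. -/
def monomialSpan (F : Type*) {K ι : Type*} [Field F] [Field K] [Algebra F K] [Fintype ι]
    (r : ι → K) (C : ℕ) : Submodule F K :=
  Submodule.span F {x | ∃ e : ι → ℕ, ∑ i, e i ≤ C ∧ x = ∏ i, r i ^ e i}

theorem monomialSpan_mono (r : ι → K) : Monotone (monomialSpan F r) := by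
  intro C C' h
  exact Submodule.span_mono fun x ⟨e, he, hx⟩ => ⟨e, he.trans h, hx⟩

theorem mul_mem_monomialSpan (r : ι → K) {C : ℕ} (i : ι) {x : K} (hx : x ∈ monomialSpan F r C) :
    r i * x ∈ monomialSpan F r (C + 1) := by
  classical
  induction hx using Submodule.span_induction with
  | mem x hx =>
    obtain ⟨e, he, rfl⟩ := hx
    refine Submodule.subset_span ⟨e + Pi.single i 1, ?_, ?_⟩
    · simp only [Pi.add_apply, Finset.sum_add_distrib, Finset.sum_pi_single', Finset.mem_univ,
        if_true]
      omega
    · simp only [Pi.add_apply, pow_add, Finset.prod_mul_distrib]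
      rw [mul_comm]
      congr 1
      rw [Finset.prod_eq_single i] <;> simp +contextual
  | zero => simp
  | add x y _ _ hx hy => rw [mul_add]; exact add_mem hx hy
  | smul c x _ hx => rw [mul_smul_comm]; exact Submodule.smul_mem _ _ hx

theorem monomialSpan_eq_top {r : ι → K} (hr : Algebra.adjoin F (Set.range r) = ⊤) {C : ℕ}
    (hC : monomialSpan F r (C + 1) ≤ monomialSpan F r C) : monomialSpan F r C = ⊤ := by
  refine eq_top_iff.2 fun x hx0 => ?_
  clear hx0
  have hx : x ∈ Algebra.adjoin F (Set.range r) := hr ▸ Algebra.mem_top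
  have h1 : (1 : K) ∈ monomialSpan F r C :=
    Submodule.subset_span ⟨0, by simp, by simp⟩
  suffices h : ∀ y ∈ monomialSpan F r C, x * y ∈ monomialSpan F r C by simpa using h 1 h1
  induction hx using Algebra.adjoin_induction with
  | mem x hx =>
    obtain ⟨i, rfl⟩ := hx
    exact fun y hy => hC (mul_mem_monomialSpan r i hy)
  | algebraMap c =>
    intro y hy
    rw [← Algebra.smul_def]
    exact Submodule.smul_mem _ _ hy
  | add a b _ _ ha hb => exact fun y hy => by rw [add_mul]; exact add_mem (ha y hy) (hb y hy)
  | mul a b _ _ ha hb => exact fun y hy => by rw [mul_assoc]; exact ha _ (hb y hy)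

theorem monomialSpan_finrank [FiniteDimensional F K] {r : ι → K}
    (hr : Algebra.adjoin F (Set.range r) = ⊤) :
    monomialSpan F r (Module.finrank F K) = ⊤ := by
  by_contra hne
  have hlt : ∀ C ≤ Module.finrank F K, C ≤ Module.finrank F (monomialSpan F r C) := by
    intro C
    induction C with
    | zero => simp
    | succ C ih =>
      intro hC
      refine (ih (by omega)).trans_lt (Submodule.finrank_lt_finrank_of_lt
        (lt_of_le_not_ge (monomialSpan_mono r (by omega)) fun h => hne ?_))
      exact eq_top_iff.2 ((monomialSpan_eq_top hr h).ge.trans (monomialSpan_mono r (by omega)))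
  exact hne (Submodule.eq_top_of_finrank_eq
    ((Submodule.finrank_le _).antisymm (hlt _ le_rfl)))

theorem exists_basis_monomials [FiniteDimensional F K] {r : ι → K}
    (hr : Algebra.adjoin F (Set.range r) = ⊤) :
    ∃ b : Fin (Module.finrank F K) → K, LinearIndependent F b ∧
      ∀ j, ∃ e : ι → ℕ, ∑ i, e i ≤ Module.finrank F K ∧ b j = ∏ i, r i ^ e i := by
  have hs := (monomialSpan_finrank hr).ge
  let b := Module.Basis.ofSpan hs
  have := Module.Finite.finite_basis b
  let e := Finite.equivFinOfCardEq (Module.finrank_eq_nat_card_basis b).symm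
  exact ⟨fun j => b (e.symm j), b.linearIndependent.comp _ e.symm.injective,
    fun j => Module.Basis.ofSpan_subset hs ⟨_, rfl⟩⟩

end Monomials

section SplittingField

variable {k F K : Type*} [Field k] [Field F] [Algebra k[X] F] [IsFractionRing k[X] F] [Algebra k F]
  [IsScalarTower k k[X] F]

theorem separable_map_sub_C [IsAlgClosed k] {P : k[X]} (hP : derivative P ≠ 0) :
    (P.map (algebraMap k F) - C (algebraMap k[X] F X)).Separable := by
  rw [Separable, derivative_sub, derivative_C, sub_zero, derivative_map,
    (IsAlgClosed.splits (derivative P)).eq_prod_roots, Polynomial.map_mul, map_C]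
  refine IsCoprime.mul_right ?_ ?_
  · refine ⟨0, C (algebraMap k F (derivative P).leadingCoeff⁻¹), ?_⟩
    rw [zero_mul, zero_add, ← C_mul, ← map_mul, inv_mul_cancel₀ (leadingCoeff_ne_zero.2 hP),
      map_one, C_1]
  · induction (derivative P).roots using Multiset.induction_on with
    | empty => simpa using isCoprime_one_right
    | cons c s ih =>
      rw [Multiset.map_cons, Multiset.prod_cons, Polynomial.map_mul]
      refine IsCoprime.mul_right ?_ ih
      rw [Polynomial.map_sub, map_X, map_C, isCoprime_comm,
        (irreducible_X_sub_C _).coprime_iff_not_dvd, dvd_iff_isRoot, IsRoot, eval_sub, eval_C,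
        eval_map_algebraMap, aeval_algebraMap_apply, IsScalarTower.algebraMap_apply k k[X] F,
        ← map_sub]
      rw [map_eq_zero_iff _ (IsFractionRing.injective k[X] F), sub_eq_zero]
      exact fun h => X_ne_C _ h.symm

variable [CharP k 2] [Field K] [Algebra k K] [Algebra F K] [IsScalarTower k F K]

omit [CharP k 2] in
theorem natDegree_X_sq_add_X : (X ^ 2 + X : k[X]).natDegree = 2 := by
  compute_degree!

theorem derivative_comp_sq_add_self {H : k[X]} (hH : derivative H ≠ 0) :
    derivative (H.comp (X ^ 2 + X)) ≠ 0 := by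
  have h2 : (2 : k[X]) = 0 := CharTwo.two_eq_zero
  have : derivative (X ^ 2 + X : k[X]) = 1 := by
    simp [derivative_pow, show (C (2:k)) = (0 : k[X]) by rw [C_eq_zero]; exact CharTwo.two_eq_zero]
  rw [derivative_comp, this, one_mul, Ne, comp_eq_zero_iff, not_or]
  refine ⟨hH, fun ⟨_, h⟩ => ?_⟩
  have := congrArg natDegree h
  rw [natDegree_C, natDegree_X_sq_add_X] at this
  exact two_ne_zero this

/-- The polynomial `H(U² + U) - T` over `F`, where `T` is the generator of `k[T]`. -/
noncomputable def coverPolynomial (F : Type*) {k : Type*} [Field k] [Field F] [Algebra k[X] F]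
    [Algebra k F] (H : k[X]) : F[X] :=
  (H.comp (X ^ 2 + X)).map (algebraMap k F) - C (algebraMap k[X] F X)

theorem exists_roots_coverPolynomial [IsAlgClosed k] {H : k[X]} (hH : H.Monic)
    (hH' : derivative H ≠ 0) [(coverPolynomial F H).IsSplittingField F K] :
    ∃ r : Fin H.natDegree → K,
      ∏ i, (X - C (r i ^ 2 + r i)) =
        H.map (algebraMap k K) - C (algebraMap F K (algebraMap k[X] F X)) ∧
      (∀ ρ ∈ (coverPolynomial F H).rootSet K, ∃ i, ρ ^ 2 + ρ = r i ^ 2 + r i) := by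
  classical
  have hQ' : derivative (H.comp (X ^ 2 + X)) ≠ 0 := derivative_comp_sq_add_self hH'
  have hsep : (coverPolynomial F H).Separable := separable_map_sub_C hQ'
  have hsplit := IsSplittingField.splits K (coverPolynomial F H)
  have hdeg : (coverPolynomial F H).natDegree = 2 * H.natDegree := by
    rw [coverPolynomial, natDegree_sub_C, natDegree_map, natDegree_comp, natDegree_X_sq_add_X,
      mul_comm]
  have hQ0 : coverPolynomial F H ≠ 0 := hsep.ne_zero
  have h2 : (2 : K) = 0 := by
    rw [← map_ofNat (algebraMap k K), CharTwo.two_eq_zero, map_zero]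
  set T := algebraMap F K (algebraMap k[X] F X) with hT
  let h : K[X] := H.map (algebraMap k K) - C T
  have hd : H.natDegree ≠ 0 := fun h0 => hH' (by
    rw [eq_C_of_natDegree_eq_zero h0, derivative_C])
  have hh : h.Monic := by
    refine (hH.map _).sub_of_left ?_
    rw [degree_map, degree_eq_natDegree hH.ne_zero]
    exact degree_C_le.trans_lt (by exact_mod_cast Nat.pos_of_ne_zero hd)
  have hhdeg : h.natDegree = H.natDegree := by rw [natDegree_sub_C, natDegree_map]
  let R := ((coverPolynomial F H).rootSet K).toFinset
  have hRroot : ∀ ρ ∈ R, h.IsRoot (ρ ^ 2 + ρ) := by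
    intro ρ hρ
    have := (mem_rootSet.1 (Set.mem_toFinset.1 hρ)).2
    rw [coverPolynomial, map_sub, aeval_C, aeval_map_algebraMap, aeval_comp] at this
    simpa [h] using this
  let Z := R.image fun ρ => ρ ^ 2 + ρ
  have hZroot : ∀ z ∈ Z, h.IsRoot z := by
    intro z hz
    obtain ⟨ρ, hρ, rfl⟩ := Finset.mem_image.1 hz
    exact hRroot ρ hρ
  have hRcard : R.card = 2 * H.natDegree := by
    rw [← hdeg, ← card_rootSet_eq_natDegree hsep hsplit, Set.toFinset_card]
  have hcard : H.natDegree ≤ Z.card := by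
    have : R.card ≤ 2 * Z.card := Finset.card_le_mul_card_image (f := fun ρ => ρ ^ 2 + ρ) R 2 (by
      intro z hz
      obtain ⟨ρ, hρ, rfl⟩ := Finset.mem_image.1 hz
      refine (Finset.card_le_card (t := {ρ, ρ + 1}) fun x hx => ?_).trans Finset.card_le_two
      have hx := (Finset.mem_filter.1 hx).2
      have : (x - ρ) * (x - (ρ + 1)) = 0 := by
        linear_combination hx + (ρ ^ 2 + ρ - x * ρ - x) * h2
      rcases mul_eq_zero.1 this with h | h
      · simp [sub_eq_zero.1 h]
      · simp [sub_eq_zero.1 h])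
    omega
  have hroots : Z.val = h.roots := by
    refine Multiset.eq_of_le_of_card_le ?_ ?_
    · rw [Multiset.le_iff_subset Z.nodup]
      exact fun z hz => (mem_roots hh.ne_zero).2 (hZroot z hz)
    · refine (card_roots' h).trans ?_
      rw [hhdeg]
      exact hcard
  have hcardeq : Z.card = H.natDegree :=
    ((congrArg Multiset.card hroots).trans_le ((card_roots' h).trans hhdeg.le)).antisymm hcard
  have hprod : ∏ z ∈ Z, (X - C z) = h := by
    rw [Finset.prod, hroots]
    exact prod_multiset_X_sub_C_of_monic_of_roots_card_eq hh (by rw [← hroots, hhdeg]; exact hcardeq)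
  let e := Z.equivFinOfCardEq hcardeq
  have hex : ∀ i, ∃ ρ, ρ ^ 2 + ρ = (e.symm i : K) := by
    intro i
    obtain ⟨ρ, -, h⟩ := Finset.mem_image.1 (e.symm i).2
    exact ⟨ρ, h⟩
  choose r hr using hex
  refine ⟨r, ?_, fun ρ hρ => ?_⟩
  · simp_rw [hr]
    rw [e.symm.prod_comp (fun z : Z => X - C (z : K)), Finset.prod_coe_sort Z (fun z => X - C z),
      hprod]
  · have hz : ρ ^ 2 + ρ ∈ Z := Finset.mem_image_of_mem _ (Set.mem_toFinset.2 hρ)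
    exact ⟨e ⟨_, hz⟩, by rw [hr, Equiv.symm_apply_apply]⟩

end SplittingField

theorem IsSplittingCover.card_le {G k S : Type*} {d : ℕ} [Field k] [CommRing S] [IsDomain S]
    [CharP S 2] [Algebra k S] [Algebra k[X] S] [IsScalarTower k k[X] S] [Group G] [Finite G]
    [MulSemiringAction G S] [IsGaloisGroup G k[X] S] {H : k[X]} {r : Fin d → S}
    (hr : IsSplittingCover G H r) : Nat.card G ≤ (2 * d) ^ d := by
  have h := fun (σ : G) i => hr.exists_smul_eq σ i
  choose j ε h using h
  have hinj : Function.Injective fun (σ : G) i => (ε σ i, j σ i) := by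
    intro σ τ hστ
    have h1 : ∀ i, ε σ i = ε τ i ∧ j σ i = j τ i := fun i => Prod.ext_iff.1 (congrFun hστ i)
    rw [← inv_mul_eq_one]
    refine (hr.eq_one _ fun i => ?_)
    rw [mul_smul, inv_smul_eq_iff, h, h, (h1 i).1, (h1 i).2]
  refine (Nat.card_le_card_of_injective _ hinj).trans_eq ?_
  simp

section

universe u

variable {k : Type u} [Field k] [IsAlgClosed k] [CharP k 2]

theorem exists_isSplittingCover_of_isSplittingField (F K : Type u) [Field F] [Field K]
    [Algebra k[X] F] [IsFractionRing k[X] F] [Algebra k F] [IsScalarTower k k[X] F] [Algebra k K]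
    [Algebra F K] [IsScalarTower k F K] [Algebra k[X] K] [IsScalarTower k[X] F K]
    [IsScalarTower k k[X] K] {H : k[X]} (hH : H.Monic) (hd : (H.natDegree : k) ≠ 0)
    [hK : (coverPolynomial F H).IsSplittingField F K] :
    ∃ (S G : Type u) (_ : CommRing S) (_ : IsDedekindDomain S) (_ : Algebra k S)
      (_ : Algebra k[X] S) (_ : IsScalarTower k k[X] S) (_ : FaithfulSMul k[X] S)
      (_ : Module.Finite k[X] S) (_ : Group G) (_ : Finite G) (_ : MulSemiringAction G S)
      (_ : IsGaloisGroup G k[X] S) (r : Fin H.natDegree → S) (D : ℕ) (b : Fin D → S),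
      IsSplittingCover G H r ∧ D = Nat.card G ∧ LinearIndependent k[X] b ∧
      ∀ j, ∃ e : Fin H.natDegree → ℕ, ∑ i, e i ≤ D ∧ b j = ∏ i, r i ^ e i := by
  have hH' : derivative H ≠ 0 := by
    intro h
    have h1 : (derivative H).coeff (H.natDegree - 1) = 0 := by rw [h, coeff_zero]
    have hpos : 1 ≤ H.natDegree := Nat.one_le_iff_ne_zero.2 fun h0 => hd (by simp [h0])
    rw [coeff_derivative, ← Nat.cast_succ, Nat.succ_eq_add_one, Nat.sub_add_cancel hpos,
      hH.coeff_natDegree, one_mul] at h1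
    exact hd h1
  let Q := coverPolynomial F H
  have hsep : Q.Separable := separable_map_sub_C (derivative_comp_sq_add_self hH')
  have : IsGalois F K := IsGalois.of_separable_splitting_field hsep
  have : FiniteDimensional F K := IsSplittingField.finiteDimensional K Q
  obtain ⟨r, hprod, hroot⟩ := exists_roots_coverPolynomial (F := F) (K := K) hH hH'
  rw [← IsScalarTower.algebraMap_apply k[X] F K] at hprod
  let S := integralClosure k[X] K
  have : IsFractionRing S K := IsIntegralClosure.isFractionRing_of_finite_extension k[X] F K S
  have : IsDedekindDomain S := integralClosure.isDedekindDomain k[X] F K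
  have hfaithful : FaithfulSMul k[X] S := by
    have := FaithfulSMul.trans k[X] F K
    have h1 := FaithfulSMul.algebraMap_injective k[X] K
    rw [IsScalarTower.algebraMap_eq k[X] S K] at h1
    exact (faithfulSMul_iff_algebraMap_injective k[X] S).2 fun a b h =>
      h1 (congrArg (algebraMap S K) h)
  have : Module.Finite k[X] S := IsIntegralClosure.finite k[X] F K S
  let : MulSemiringAction Gal(K/F) S := IsIntegralClosure.MulSemiringAction k[X] F K S
  have : IsGaloisGroup Gal(K/F) k[X] S := IsGaloisGroup.of_isFractionRing _ _ _ F K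
  have h2 : (2 : K) = 0 := by
    rw [← map_ofNat (algebraMap k K), CharTwo.two_eq_zero, map_zero]
  have hrT : ∀ i, aeval (r i ^ 2 + r i) H = algebraMap k[X] K X := by
    intro i
    have := congrArg (eval (r i ^ 2 + r i)) hprod
    rw [eval_prod, Finset.prod_eq_zero (Finset.mem_univ i) (by simp), eval_sub, eval_C,
      eval_map_algebraMap] at this
    exact (sub_eq_zero.1 this.symm)
  have hrint : ∀ i, IsIntegral k[X] (r i) := by
    intro i
    have hmonic : (H.comp (X ^ 2 + X)).Monic :=
      hH.comp (by monicity!) (by rw [natDegree_X_sq_add_X]; exact two_ne_zero)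
    refine ⟨(H.comp (X ^ 2 + X)).map (algebraMap k k[X]) - C X, ?_, ?_⟩
    · refine (hmonic.map _).sub_of_left ?_
      rw [degree_map, degree_eq_natDegree hmonic.ne_zero]
      refine degree_C_le.trans_lt ?_
      rw [natDegree_comp, natDegree_X_sq_add_X]
      have : H.natDegree ≠ 0 := fun h0 => hd (by simp [h0])
      exact_mod_cast (by omega : 0 < H.natDegree * 2)
    · rw [← aeval_def, map_sub, aeval_map_algebraMap, aeval_comp, aeval_C]
      simp [hrT]
  have hroot_cases : ∀ ρ ∈ Q.rootSet K, ∃ i, ρ = r i ∨ ρ = r i + 1 := by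
    intro ρ hρ
    obtain ⟨i, hi⟩ := hroot ρ hρ
    have : (ρ - r i) * (ρ - (r i + 1)) = 0 := by
      linear_combination hi + (r i ^ 2 + r i - ρ * r i - ρ) * h2
    rcases mul_eq_zero.1 this with h | h
    · exact ⟨i, Or.inl (sub_eq_zero.1 h)⟩
    · exact ⟨i, Or.inr (sub_eq_zero.1 h)⟩
  have hadjoin := IsSplittingField.adjoin_rootSet K Q
  have htop : Algebra.adjoin F (Set.range r) = ⊤ := by
    refine top_le_iff.1 (hadjoin.ge.trans (Algebra.adjoin_le fun ρ hρ => ?_))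
    have hmem : ∀ i, r i ∈ Algebra.adjoin F (Set.range r) := fun i =>
      Algebra.subset_adjoin ⟨i, rfl⟩
    obtain ⟨i, rfl | rfl⟩ := hroot_cases ρ hρ
    · exact hmem i
    · exact add_mem (hmem i) (one_mem _)
  obtain ⟨b, hb, hbr⟩ := exists_basis_monomials htop
  let rS : Fin H.natDegree → S := fun i => ⟨r i, hrint i⟩
  have hinj : Function.Injective (algebraMap S K) := Subtype.val_injective
  choose e he hbe using hbr
  let bS : Fin (Module.finrank F K) → S := fun j => ∏ i, rS i ^ e j i
  have hbS : ∀ j, algebraMap S K (bS j) = b j := by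
    intro j
    rw [hbe, map_prod]
    simp only [map_pow]
    rfl
  refine ⟨S, Gal(K/F), inferInstance, inferInstance, inferInstance, inferInstance, inferInstance,
    inferInstance, inferInstance, inferInstance, inferInstance, inferInstance, inferInstance, rS,
    Module.finrank F K, bS, ⟨?_, ?_⟩, ?_, ?_, fun j => ⟨e j, he j, rfl⟩⟩
  · refine Polynomial.map_injective _ hinj ?_
    rw [Polynomial.map_prod, Polynomial.map_sub, Polynomial.map_map,
      ← IsScalarTower.algebraMap_eq k S K, map_C, ← IsScalarTower.algebraMap_apply]
    refine Eq.trans (Finset.prod_congr rfl fun i _ => ?_) hprod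
    rw [Polynomial.map_sub, map_X, map_C]
    rfl
  · intro σ hσ
    have hfix : ∀ i, σ (r i) = r i := by
      intro i
      have := congrArg (algebraMap S K) (hσ i)
      exact (algebraMap_galRestrict_apply k[X] σ (rS i)).symm.trans this
    have : (σ : K →ₐ[F] K) = AlgHom.id F K := by
      refine AlgHom.ext_of_adjoin_eq_top hadjoin fun ρ hρ => ?_
      obtain ⟨i, rfl | rfl⟩ := hroot_cases ρ hρ
      · exact hfix i
      · simp [hfix i]
    ext x
    exact DFunLike.congr_fun this x
  · exact (IsGalois.card_aut_eq_finrank F K).symm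
  · have hb' : LinearIndependent k[X] b := hb.restrict_scalars' k[X]
    refine LinearIndependent.of_comp (IsScalarTower.toAlgHom k[X] S K).toLinearMap ?_
    convert hb' using 1
    exact funext hbS

theorem exists_isSplittingCover {H : k[X]} (hH : H.Monic) (hd : (H.natDegree : k) ≠ 0) :
    ∃ (S G : Type u) (_ : CommRing S) (_ : IsDedekindDomain S) (_ : Algebra k S)
      (_ : Algebra k[X] S) (_ : IsScalarTower k k[X] S) (_ : FaithfulSMul k[X] S)
      (_ : Module.Finite k[X] S) (_ : Group G) (_ : Finite G) (_ : MulSemiringAction G S)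
      (_ : IsGaloisGroup G k[X] S) (r : Fin H.natDegree → S) (D : ℕ) (b : Fin D → S),
      IsSplittingCover G H r ∧ D = Nat.card G ∧ LinearIndependent k[X] b ∧
      ∀ j, ∃ e : Fin H.natDegree → ℕ, ∑ i, e i ≤ D ∧ b j = ∏ i, r i ^ e i :=
  have : IsScalarTower k k[X] (coverPolynomial (FractionRing k[X]) H).SplittingField :=
    IsScalarTower.of_algebraMap_eq fun x => by
      rw [IsScalarTower.algebraMap_apply k (FractionRing k[X]), IsScalarTower.algebraMap_apply k k[X],
        ← IsScalarTower.algebraMap_apply k[X]]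
  exists_isSplittingCover_of_isSplittingField (FractionRing k[X])
    (coverPolynomial (FractionRing k[X]) H).SplittingField hH hd

end

/-- Over large finite fields of characteristic 2, a Morse polynomial `H` satisfying the obvious
necessary condition on its second coefficient has a value `t`, in any set `A` of noncritical
values with bounded complement, for which all solutions of `H(u² + u) = t` are rational. -/
theorem exists_forall_eval_sq_add_self_eq {k : Type*} [Field k] [IsAlgClosed k] [CharP k 2]
    (d B : ℕ) (hd : (d : k) ≠ 0) (hd2 : 2 ≤ d) :
    ∃ n₀, ∀ n ≥ n₀, ∀ H : k[X], H.Monic → H.natDegree = d → IsMorse H →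
      (∀ i, H.coeff i ^ 2 ^ n = H.coeff i) → ∀ w : k, w ^ 2 ^ n = w → w ^ 2 + w = H.nextCoeff →
      ∀ A : Finset k, 2 ^ n ≤ A.card + B → (∀ t ∈ A, t ^ 2 ^ n = t) →
      (∀ t ∈ A, ∀ y, (derivative H).eval y = 0 → H.eval y ≠ t) →
      ∃ t ∈ A, ∀ u, H.eval (u ^ 2 + u) = t → u ^ 2 ^ n = u := by
  have h := fun D : ℕ => exists_parameters (D + 1) (D + 1) B (by omega)
  choose f hf using h
  refine ⟨(Finset.range ((2 * d) ^ d)).sup f, ?_⟩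
  intro n hn H hH hHd hM hHq w hwq hw A hA hAq hAcrit
  subst hHd
  obtain ⟨S, G, _, _, _, _, _, _, _, _, _, _, hG, r, D, b, hr, hDG, hb, hbr⟩ :=
    exists_isSplittingCover hH hd
  have : CharP S 2 := charP_of_injective_algebraMap (algebraMap k S).injective 2
  have hD1 : D ≠ 0 := by rw [hDG]; exact Nat.card_pos.ne'
  obtain ⟨D, rfl⟩ := Nat.exists_eq_add_one_of_ne_zero hD1
  have hDle : D < (2 * H.natDegree) ^ H.natDegree := by
    have := hr.card_le
    omega
  obtain ⟨μ, ν, l, m, h1, h2, h3, h4⟩ :=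
    hf D n ((Finset.le_sup (f := f) (Finset.mem_range.2 hDle)).trans hn)
  obtain ⟨Γ, _, v, hv⟩ := exists_isPlaceAtInfinity (k := k) (S := S)
  obtain ⟨φ, hφA, hφ⟩ := hr.exists_forall_pow_eq hv hd hd2 hM hHq hwq hw (J := Fin (D + 1))
    (by rw [Fintype.card_fin, hDG, IsGaloisGroup.card_eq_finrank' G k[X] S]) hb hbr A hA hAq hAcrit
    (by simp) h1 h2 h3 h4
  refine ⟨_, hφA, fun u hu => ?_⟩
  have := congrArg (eval (u ^ 2 + u)) (hr.map_prod_eq φ)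
  rw [eval_prod, eval_sub, hu, eval_C, sub_self, Finset.prod_eq_zero_iff] at this
  obtain ⟨i, -, hi⟩ := this
  rw [eval_sub, eval_X, eval_C, sub_eq_zero] at hi
  obtain ⟨ε, rfl⟩ := exists_eq_add_cast_of_sq_add_self_eq hi
  have := Fact.mk Nat.prime_two
  rw [add_pow_char_pow, hφ i]
  rcases ε.eq_zero_or_one_of_two with rfl | rfl <;> simp

/-- The Fibonacci polynomials. In characteristic 2 they express `u^j + (u+1)^j` in terms of
`u^2 + u`. -/
noncomputable def fibPolynomial (R : Type*) [CommRing R] : ℕ → R[X]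
  | 0 => 0
  | 1 => 1
  | j + 2 => fibPolynomial R (j + 1) + X * fibPolynomial R j

theorem aeval_fibPolynomial {R A : Type*} [CommRing R] [CommRing A] [Algebra R A] [CharP A 2]
    (a : A) (j : ℕ) : aeval (a ^ 2 + a) (fibPolynomial R j) = a ^ j + (a + 1) ^ j := by
  have h2 : (2 : A) = 0 := CharTwo.two_eq_zero
  induction j using Nat.twoStepInduction with
  | zero =>
    simp [fibPolynomial, one_add_one_eq_two, h2]
  | one =>
    simp only [fibPolynomial, map_one, pow_one]
    linear_combination -a * h2
  | more j h1 h3 =>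
    simp only [fibPolynomial, map_add, map_mul, aeval_X, h1, h3]
    linear_combination a * a ^ j * h2

theorem coeff_fibPolynomial_succ (R : Type*) [CommRing R] (j i : ℕ) :
    (fibPolynomial R (j + 1)).coeff i = ((j - i).choose i : ℕ) := by
  induction j using Nat.twoStepInduction generalizing i with
  | zero => cases i <;> simp [fibPolynomial, coeff_one]
  | one =>
    rcases i with _ | _ | i <;> simp [fibPolynomial, coeff_one]
  | more j h1 h3 =>
    rw [fibPolynomial, coeff_add, h3]
    cases i with
    | zero => simp
    | succ i =>
      rw [coeff_X_mul, h1]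
      rcases le_or_gt i j with h | h
      · rw [show j + 2 - (i + 1) = (j - i) + 1 by omega, show j + 1 - (i + 1) = j - i by omega,
          Nat.choose_succ_succ]
        push_cast
        ring
      · rw [Nat.choose_eq_zero_of_lt (by omega), Nat.choose_eq_zero_of_lt (by omega),
          Nat.choose_eq_zero_of_lt (by omega)]
        simp

/-- For `f = x^(2d+1) + s x^(2d+2) + c x^(2d)` in characteristic 2, this is the polynomial `H`
with `f(u+1) + f(u) = H(u² + u)`. -/
noncomputable def trinomialDifference {R : Type*} [CommRing R] (d : ℕ) (s c : R) : R[X] :=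
  fibPolynomial R (2 * d + 1) + C s * fibPolynomial R (2 * d + 2) + C c * fibPolynomial R (2 * d)

section TrinomialDifference

variable {k : Type*} [Field k] {d : ℕ}

theorem aeval_trinomialDifference {A : Type*} [CommRing A] [Algebra k A] [CharP A 2] (d : ℕ)
    (s c : k) (a : A) :
    aeval (a ^ 2 + a) (trinomialDifference d s c) =
      a ^ (2 * d + 1) + (a + 1) ^ (2 * d + 1)
        + algebraMap k A s * (a ^ (2 * d + 2) + (a + 1) ^ (2 * d + 2))
        + algebraMap k A c * (a ^ (2 * d) + (a + 1) ^ (2 * d)) := by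
  simp only [trinomialDifference, map_add, map_mul, aeval_C, aeval_fibPolynomial]

theorem coeff_trinomialDifference (s c : k) (i : ℕ) :
    (trinomialDifference (d + 1) s c).coeff i = ((2 * d + 2 - i).choose i : ℕ) +
      s * ((2 * d + 3 - i).choose i : ℕ) + c * ((2 * d + 1 - i).choose i : ℕ) := by
  rw [trinomialDifference, coeff_add, coeff_add, coeff_C_mul, coeff_C_mul]
  simp only [show 2 * (d + 1) = 2 * d + 1 + 1 by ring, coeff_fibPolynomial_succ]

theorem coeff_trinomialDifference_eq_zero (s c : k) {i : ℕ} (hi : d + 1 < i) :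
    (trinomialDifference (d + 1) s c).coeff i = 0 := by
  rw [coeff_trinomialDifference, Nat.choose_eq_zero_of_lt (by omega),
    Nat.choose_eq_zero_of_lt (by omega), Nat.choose_eq_zero_of_lt (by omega)]
  simp

variable [CharP k 2]

theorem coeff_trinomialDifference_self (hd : Even d) (s c : k) :
    (trinomialDifference (d + 1) s c).coeff (d + 1) = 1 := by
  rw [coeff_trinomialDifference, show 2 * d + 2 - (d + 1) = d + 1 by omega,
    show 2 * d + 3 - (d + 1) = d + 1 + 1 by omega, show 2 * d + 1 - (d + 1) = d by omega,
    Nat.choose_self, Nat.choose_succ_self_right, Nat.choose_eq_zero_of_lt (Nat.lt_succ_self d),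
    (CharP.cast_eq_zero_iff k 2 (d + 1 + 1)).2 (by have := hd.two_dvd; omega)]
  simp

theorem natDegree_trinomialDifference (hd : Even d) (s c : k) :
    (trinomialDifference (d + 1) s c).natDegree = d + 1 := by
  refine natDegree_eq_of_le_of_coeff_ne_zero (natDegree_le_iff_coeff_eq_zero.2 fun i hi =>
    coeff_trinomialDifference_eq_zero s c hi) ?_
  rw [coeff_trinomialDifference_self hd]
  exact one_ne_zero

theorem monic_trinomialDifference (hd : Even d) (s c : k) :
    (trinomialDifference (d + 1) s c).Monic := by
  rw [Monic, leadingCoeff, natDegree_trinomialDifference hd, coeff_trinomialDifference_self hd]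

theorem nextCoeff_trinomialDifference (e : ℕ) (s c : k) :
    (trinomialDifference (2 * e + 1) s c).nextCoeff = (e + 1 : ℕ) * (1 + s) + c := by
  rw [nextCoeff_of_natDegree_pos (by rw [natDegree_trinomialDifference ⟨e, by ring⟩]; omega),
    natDegree_trinomialDifference ⟨e, by ring⟩, Nat.add_sub_cancel, coeff_trinomialDifference,
    show 2 * (2 * e) + 2 - 2 * e = 2 * e + 2 by omega,
    show 2 * (2 * e) + 3 - 2 * e = 2 * e + 3 by omega,
    show 2 * (2 * e) + 1 - 2 * e = 2 * e + 1 by omega, Nat.choose_symm_add, Nat.choose_symm_add,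
    Nat.choose_symm_add, Nat.choose_one_right]
  have key : ∀ a b : ℕ, a % 2 = b % 2 → (a : k) = b := fun a b h =>
    (CharP.cast_eq_iff_mod_eq k 2).2 h
  have h2 : (2 * e + 2).choose 2 = (e + 1) * (2 * e + 1) := by
    rw [Nat.choose_two_right, show (2 * e + 2) * (2 * e + 2 - 1) = (e + 1) * (2 * e + 1) * 2 by
      rw [show 2 * e + 2 - 1 = 2 * e + 1 by omega]; ring]
    simp
  have h3 : (2 * e + 3).choose 3 * 3 = (2 * e + 3) * ((e + 1) * (2 * e + 1)) := by
    rw [← h2, Nat.add_one_mul_choose_eq]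
  have h4 : (e + 1) * (2 * e + 1) = (e + 1) + 2 * (e * (e + 1)) := by ring
  have h5 : (2 * e + 3) * ((e + 1) * (2 * e + 1)) =
      (e + 1) + 2 * ((e + 1) * (2 * e * e + 4 * e + 1)) := by ring
  rw [key ((2 * e + 2).choose 2) (e + 1) (by omega), key ((2 * e + 3).choose 3) (e + 1) (by omega),
    key (2 * e + 1) 1 (by omega)]
  push_cast
  ring

omit [CharP k 2] in
theorem exists_sq_add_self_eq [IsAlgClosed k] (y : k) : ∃ u : k, u ^ 2 + u = y := by
  obtain ⟨u, hu⟩ := IsAlgClosed.exists_root (X ^ 2 + X - C y) (by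
    rw [show (X ^ 2 + X - C y : k[X]).degree = 2 by compute_degree!]; norm_num)
  refine ⟨u, ?_⟩
  simpa [sub_eq_zero] using hu

theorem derivative_trinomialDifference [IsAlgClosed k] (d : ℕ) (s c : k) :
    derivative (trinomialDifference d s c) = fibPolynomial k (2 * d) := by
  have h2 : (2 : k[X]) = 0 := CharTwo.two_eq_zero
  have hC2 : (C 2 : k[X]) = 0 := by rw [← h2]; rfl
  have hcomp : (trinomialDifference d s c).comp (X ^ 2 + X) =
      X ^ (2 * d + 1) + (X + 1) ^ (2 * d + 1) + C s * (X ^ (2 * d + 2) + (X + 1) ^ (2 * d + 2))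
        + C c * (X ^ (2 * d) + (X + 1) ^ (2 * d)) :=
    aeval_trinomialDifference d s c (X : k[X])
  have hder := congrArg derivative hcomp
  rw [derivative_comp] at hder
  have hfun : ∀ u : k, (derivative (trinomialDifference d s c)).eval (u ^ 2 + u) =
      (fibPolynomial k (2 * d)).eval (u ^ 2 + u) := by
    intro u
    have h := congrArg (eval u) hder
    have h20 : (2 : k) = 0 := CharTwo.two_eq_zero
    have hf := aeval_fibPolynomial (R := k) u (2 * d)
    rw [coe_aeval_eq_eval] at hf
    rw [hf]
    simpa [derivative_pow, h20] using h
  refine Polynomial.funext fun y => ?_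
  obtain ⟨u, hu⟩ := exists_sq_add_self_eq y
  rw [← hu, hfun]

theorem isMorse_trinomialDifference [IsAlgClosed k] {e : ℕ} {s c : k} (hs : s ≠ 1)
    (hc : (fibPolynomial k (2 * (2 * e + 1))).eval c ≠ 0)
    (hM : ∀ ζ₁ ζ₂ : k, ζ₁ ≠ 1 → ζ₂ ≠ 1 → ζ₁ ^ (2 * (2 * e + 1)) = 1 → ζ₂ ^ (2 * (2 * e + 1)) = 1 →
      ((1 + ζ₁) / (1 + ζ₂)) ^ (2 * (2 * e + 1)) = 1 → ζ₁ = ζ₂ ∨ ζ₁ = ζ₂⁻¹) :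
    IsMorse (trinomialDifference (2 * e + 1) s c) := by
  have h2 : (2 : k) = 0 := CharTwo.two_eq_zero
  set d := 2 * e + 1 with hd
  have hfib : ∀ u : k, (fibPolynomial k (2 * d)).eval (u ^ 2 + u) =
      u ^ (2 * d) + (u + 1) ^ (2 * d) := fun u => by
    simpa using aeval_fibPolynomial (R := k) u (2 * d)
  have hcrit : ∀ y, (derivative (trinomialDifference d s c)).eval y = 0 → ∃ u, u ^ 2 + u = y ∧
      u ≠ 0 ∧ u + 1 ≠ 0 ∧ (u + 1) ^ (2 * d) = u ^ (2 * d) := by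
    intro y hy
    obtain ⟨u, rfl⟩ := exists_sq_add_self_eq y
    rw [derivative_trinomialDifference, hfib] at hy
    refine ⟨u, rfl, ?_, ?_, ?_⟩
    · rintro rfl
      simp [hd] at hy
    · intro h
      rw [h, zero_pow (by omega), add_zero, pow_eq_zero_iff (by omega)] at hy
      simp [hy] at h
    · linear_combination hy - u ^ (2 * d) * h2
  have heval : ∀ u : k, (u + 1) ^ (2 * d) = u ^ (2 * d) →
      (trinomialDifference d s c).eval (u ^ 2 + u) = (1 + s) * u ^ (2 * d) := by
    intro u hu
    have := aeval_trinomialDifference d s c u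
    rw [coe_aeval_eq_eval] at this
    rw [this, Algebra.algebraMap_self, RingHom.id_apply, RingHom.id_apply, pow_add, pow_add, pow_add,
      pow_add, hu]
    linear_combination (u ^ (2 * d) * (u + s * u ^ 2 + s * u + c)) * h2
  refine ⟨fun y z hy hz hyz => ?_, fun y hy hdvd => ?_⟩
  · obtain ⟨u, rfl, hu0, hu1, hu⟩ := hcrit y hy
    obtain ⟨v, rfl, hv0, hv1, hv⟩ := hcrit z hz
    rw [heval u hu, heval v hv] at hyz
    have hs1 : 1 + s ≠ 0 := fun h => hs (by linear_combination h - h2)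
    have huv := mul_left_cancel₀ hs1 hyz
    have hone : ∀ w : k, w ≠ 0 → 1 + (w + 1) / w = w⁻¹ := by
      intro w hw
      field_simp
      linear_combination w * h2
    have hne : ∀ w : k, w ≠ 0 → (w + 1) / w ≠ 1 := by
      intro w hw h
      rw [div_eq_one_iff_eq hw] at h
      simp at h
    rcases hM ((u + 1) / u) ((v + 1) / v) (hne u hu0) (hne v hv0)
      (by rw [div_pow, hu, div_self (pow_ne_zero _ hu0)])
      (by rw [div_pow, hv, div_self (pow_ne_zero _ hv0)])
      (by rw [hone u hu0, hone v hv0, div_pow, inv_pow, inv_pow, huv,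
        div_self (inv_ne_zero (pow_ne_zero _ hv0))]) with h | h
    · rw [div_eq_div_iff hu0 hv0] at h
      have : u = v := by linear_combination -h
      rw [this]
    · rw [inv_div, div_eq_div_iff hu0 hv1] at h
      have : u = v + 1 := by linear_combination h - (v + 1) * h2
      rw [this]
      linear_combination (v + 1) * h2
  · obtain ⟨u, rfl, hu0, hu1, hu⟩ := hcrit y hy
    obtain ⟨q, hq⟩ := hdvd
    have h2' : (2 : k[X]) = 0 := CharTwo.two_eq_zero
    have hcomp := congrArg (fun p => p.comp ((X + C u) ^ 2 + (X + C u))) hq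
    have ha : (trinomialDifference d s c).comp ((X + C u) ^ 2 + (X + C u)) =
        (X + C u) ^ (2 * d + 1) + (X + C u + 1) ^ (2 * d + 1)
        + C s * ((X + C u) ^ (2 * d + 2) + (X + C u + 1) ^ (2 * d + 2))
        + C c * ((X + C u) ^ (2 * d) + (X + C u + 1) ^ (2 * d)) :=
      aeval_trinomialDifference d s c (X + C u)
    have hX : (X + C u) ^ 2 + (X + C u) - C (u ^ 2 + u) = X * (X + 1) := by
      rw [C_add, C_pow]
      linear_combination X * C u * h2'
    simp only [sub_comp, mul_comp, pow_comp, X_comp, C_comp] at hcomp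
    rw [ha, hX, mul_pow, mul_assoc, add_assoc X (C u) 1, ← C_1, ← C_add] at hcomp
    have hcoeff := congrArg (fun p => p.coeff 2) hcomp
    simp only [coeff_sub, coeff_add, coeff_C_mul, coeff_X_add_C_pow, coeff_X_pow_mul',
      coeff_C_succ] at hcoeff
    have key : ∀ a b : ℕ, a % 2 = b % 2 → (a : k) = b := fun a b h =>
      (CharP.cast_eq_iff_mod_eq k 2).2 h
    have hchoose : ∀ a b : ℕ, a * (a - 1) = b * 2 → a.choose 2 = b := fun a b h => by
      rw [Nat.choose_two_right, h, Nat.mul_div_cancel _ two_pos]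
    rw [hchoose (2 * d + 1) (d * (2 * d + 1)) (by rw [Nat.add_sub_cancel]; ring),
      hchoose (2 * d + 2) ((d + 1) * (2 * d + 1)) (by
        rw [show 2 * d + 2 - 1 = 2 * d + 1 by omega]; ring),
      hchoose (2 * d) (d * (4 * e + 1)) (by rw [hd, show 2 * (2 * e + 1) - 1 = 4 * e + 1 by omega]
                                            ring),
      key (d * (2 * d + 1)) 1 (by
        rw [hd, show (2 * e + 1) * (2 * (2 * e + 1) + 1) = 1 + 2 * (4 * e * e + 5 * e + 1) by ring]
        omega),
      key ((d + 1) * (2 * d + 1)) 0 (by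
        rw [hd, show (2 * e + 1 + 1) * (2 * (2 * e + 1) + 1) = 2 * ((e + 1) * (4 * e + 3)) by ring]
        omega),
      key (d * (4 * e + 1)) 1 (by
        rw [hd, show (2 * e + 1) * (4 * e + 1) = 1 + 2 * (4 * e * e + 3 * e) by ring]
        omega), if_neg (by norm_num), show 2 * d + 1 - 2 = 4 * e + 1 by omega,
      show 2 * d - 2 = 4 * e by omega] at hcoeff
    push_cast at hcoeff
    rw [show 2 * d = 4 * e + 2 by omega] at hu
    have hzero : u ^ (4 * e + 2) * (u ^ 2 + u + c) = 0 := by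
      linear_combination u ^ 2 * (u + 1) ^ 2 * hcoeff - (c * u ^ 2 + u ^ 2 * (u + 1)) * hu -
        (u ^ (4 * e + 2) * (u ^ 3 + u ^ 2 + u ^ 2 * c + u * c)) * h2
    have hcu : c = u ^ 2 + u := by
      have := (mul_eq_zero.1 hzero).resolve_left (pow_ne_zero _ hu0)
      linear_combination this - (u ^ 2 + u) * h2
    refine hc ?_
    rw [hcu, hfib, show 2 * d = 4 * e + 2 by omega, hu]
    linear_combination u ^ (4 * e + 2) * h2

end TrinomialDifference

section Trace

variable {F : Type*} [Field F] [Fintype F] [CharP F 2] {n : ℕ}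

theorem exists_sq_add_self_eq_of_trace_eq_zero (hn : 1 ≤ n) (hF : Fintype.card F = 2 ^ n) {x : F}
    (hx : ∑ i ∈ Finset.range n, x ^ 2 ^ i = 0) : ∃ w : F, w ^ 2 + w = x := by
  classical
  have h2 : (2 : F) = 0 := CharTwo.two_eq_zero
  have := Fact.mk Nat.prime_two
  let T : F[X] := ∑ i ∈ Finset.range n, X ^ 2 ^ i
  have hTdeg : T.natDegree ≤ 2 ^ (n - 1) := natDegree_sum_le_of_forall_le _ _ fun i hi => by
    rw [natDegree_X_pow]
    exact Nat.pow_le_pow_right two_pos (by have := Finset.mem_range.1 hi; omega)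
  have hT0 : T ≠ 0 := by
    intro h
    have h1 := congrArg (fun p => coeff p (2 ^ 0)) h
    simp only [T, finsetSum_coeff, coeff_X_pow, (Nat.pow_right_injective le_rfl).eq_iff] at h1
    rw [Finset.sum_ite_eq, if_pos (Finset.mem_range.2 hn)] at h1
    simp at h1
  have hTeval : ∀ y, T.eval y = ∑ i ∈ Finset.range n, y ^ 2 ^ i := fun y => by
    simp [T, eval_finsetSum]
  let I : Finset F := Finset.univ.image fun w => w ^ 2 + w
  have hI : I ⊆ T.roots.toFinset := by
    intro y hy
    obtain ⟨w, -, rfl⟩ := Finset.mem_image.1 hy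
    rw [Multiset.mem_toFinset, mem_roots hT0, IsRoot, hTeval]
    have h3 : ∀ i, (w ^ 2 + w) ^ 2 ^ i = w ^ 2 ^ (i + 1) - w ^ 2 ^ i := by
      intro i
      rw [add_pow_char_pow, ← pow_mul, ← pow_succ']
      linear_combination w ^ 2 ^ i * h2
    rw [Finset.sum_congr rfl fun i _ => h3 i,
      Finset.sum_range_sub (fun i => w ^ 2 ^ i), ← hF, FiniteField.pow_card]
    simp
  have hcard : 2 ^ n ≤ 2 * I.card := by
    rw [← hF, ← Finset.card_univ]
    refine Finset.card_le_mul_card_image (f := fun w : F => w ^ 2 + w) Finset.univ 2 ?_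
    intro z hz
    obtain ⟨ρ, hρ, rfl⟩ := Finset.mem_image.1 hz
    refine (Finset.card_le_card (t := {ρ, ρ + 1}) fun x hx => ?_).trans Finset.card_le_two
    have hx := (Finset.mem_filter.1 hx).2
    have : (x - ρ) * (x - (ρ + 1)) = 0 := by
      linear_combination hx + (ρ ^ 2 + ρ - x * ρ - x) * h2
    rcases mul_eq_zero.1 this with h | h
    · simp [sub_eq_zero.1 h]
    · simp [sub_eq_zero.1 h]
  have hroots : T.roots.toFinset.card ≤ I.card := by
    have h1 := (Multiset.toFinset_card_le _).trans ((card_roots' T).trans hTdeg)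
    have h3 : 2 ^ n = 2 * 2 ^ (n - 1) := by rw [← pow_succ', Nat.sub_add_cancel hn]
    omega
  have hxI : x ∈ I := by
    rw [Finset.eq_of_subset_of_card_le hI hroots, Multiset.mem_toFinset, mem_roots hT0, IsRoot,
      hTeval, hx]
  obtain ⟨w, -, h⟩ := Finset.mem_image.1 hxI
  exact ⟨w, h⟩

theorem trace_eq_zero_or_one (hF : Fintype.card F = 2 ^ n) (x : F) :
    ∑ i ∈ Finset.range n, x ^ 2 ^ i = 0 ∨ ∑ i ∈ Finset.range n, x ^ 2 ^ i = 1 := by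
  have := Fact.mk Nat.prime_two
  have h : (∑ i ∈ Finset.range n, x ^ 2 ^ i) ^ 2 = ∑ i ∈ Finset.range n, x ^ 2 ^ i := by
    rw [sum_pow_char]
    simp_rw [← pow_mul, ← pow_succ]
    have := Finset.sum_range_succ' (fun i => x ^ 2 ^ i) n
    rw [Finset.sum_range_succ, ← hF, FiniteField.pow_card, pow_zero, pow_one] at this
    exact (add_right_cancel this).symm
  rw [sq] at h
  rcases eq_or_ne (∑ i ∈ Finset.range n, x ^ 2 ^ i) 0 with h0 | h0
  · exact Or.inl h0
  · exact Or.inr (mul_left_cancel₀ h0 (h.trans (mul_one _).symm))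

/-- The rational function `κ(1 + s) + c/s` takes values of trace zero outside any small set. -/
theorem exists_notMem_sq_add_self_eq (hn : 2 ≤ n) (hF : Fintype.card F = 2 ^ n) {κ : F}
    (hκ : κ = 0 ∨ κ = 1) (c : F) (Z : Finset F) (hZ : Z.card < 2 ^ (n - 2)) (h0 : (0 : F) ∈ Z) :
    ∃ s ∉ Z, ∃ w : F, w ^ 2 + w = κ * (1 + s) + c / s := by
  classical
  have h2 : (2 : F) = 0 := CharTwo.two_eq_zero
  have := Fact.mk Nat.prime_two
  by_contra! hcon
  have htr : ∀ s ∉ Z, ∑ i ∈ Finset.range n, (κ * (1 + s) + c / s) ^ 2 ^ i = 1 := by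
    intro s hs
    refine (trace_eq_zero_or_one hF _).resolve_left fun h => ?_
    obtain ⟨w, hw⟩ := exists_sq_add_self_eq_of_trace_eq_zero (by omega) hF h
    exact hcon s hs w hw
  obtain ⟨r, rfl⟩ := Nat.exists_eq_add_of_le' hn
  rw [Nat.add_sub_cancel] at hZ
  let τ : F := κ * (r + 2 : ℕ) + 1
  let G : F[X] := C κ * (X + ∑ i ∈ Finset.range (r + 1), X ^ (2 ^ i + 2 ^ (r + 1))) +
    C τ * X ^ 2 ^ (r + 1) + ∑ i ∈ Finset.range (r + 2), C (c ^ 2 ^ i) * X ^ (2 ^ (r + 1) - 2 ^ i)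
  have hdeg : G.natDegree ≤ 2 ^ r + 2 ^ (r + 1) := by
    have h1 : 1 ≤ 2 ^ r := Nat.one_le_two_pow
    refine natDegree_add_le_of_degree_le (natDegree_add_le_of_degree_le
      ((natDegree_C_mul_le _ _).trans (natDegree_add_le_of_degree_le ?_ ?_)) ?_) ?_
    · rw [natDegree_X]
      omega
    · refine natDegree_sum_le_of_forall_le _ _ fun i hi => ?_
      rw [natDegree_X_pow]
      have := Nat.pow_le_pow_right two_pos (Nat.lt_succ_iff.1 (Finset.mem_range.1 hi))
      omega
    · exact (natDegree_C_mul_X_pow_le _ _).trans (by omega)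
    · exact natDegree_sum_le_of_forall_le _ _ fun i hi =>
        (natDegree_C_mul_X_pow_le _ _).trans (by have := Nat.one_le_two_pow (n := i); omega)
  have hG0 : G ≠ 0 := by
    intro h
    have h1 : 1 ≤ 2 ^ r := Nat.one_le_two_pow
    have h4 : 2 ^ (r + 1) = 2 * 2 ^ r := by ring
    have hpos : ∀ i, 1 ≤ 2 ^ i := fun i => Nat.one_le_two_pow
    rcases hκ with hκ | hκ
    · have h3 := congrArg (fun p => coeff p (2 ^ (r + 1))) h
      simp only [G, τ, hκ, C_0, zero_mul, zero_add, C_1, one_mul, coeff_add, coeff_X_pow_self,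
        finsetSum_coeff, coeff_C_mul_X_pow, coeff_zero] at h3
      rw [Finset.sum_eq_zero fun i _ => if_neg (by have := hpos i; omega), add_zero] at h3
      exact one_ne_zero h3
    · have h3 := congrArg (fun p => coeff p (2 ^ r + 2 ^ (r + 1))) h
      simp only [G, hκ, C_1, one_mul, coeff_add, coeff_X, coeff_X_pow,
        finsetSum_coeff, coeff_C_mul_X_pow, coeff_zero, add_left_inj,
        (Nat.pow_right_injective le_rfl).eq_iff] at h3
      rw [Finset.sum_ite_eq, if_pos (Finset.mem_range.2 (Nat.lt_succ_self r)), if_neg (by omega),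
        if_neg (by omega), Finset.sum_eq_zero fun i _ => if_neg (by have := hpos i; omega)] at h3
      simp at h3
  have hroot : ∀ s ∉ Z, G.eval s = 0 := by
    intro s hs
    have hs0 : s ≠ 0 := fun h => hs (h ▸ h0)
    have hκi : ∀ i, κ ^ 2 ^ i = κ := by
      intro i
      rcases hκ with rfl | rfl <;> simp
    have h := htr s hs
    have hterm : ∀ i ∈ Finset.range (r + 2), s ^ 2 ^ (r + 1) * (κ * (1 + s) + c / s) ^ 2 ^ i =
        κ * s ^ 2 ^ (r + 1) + κ * s ^ (2 ^ i + 2 ^ (r + 1)) +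
          c ^ 2 ^ i * s ^ (2 ^ (r + 1) - 2 ^ i) := by
      intro i hi
      have hle : 2 ^ i ≤ 2 ^ (r + 1) :=
        Nat.pow_le_pow_right two_pos (by have := Finset.mem_range.1 hi; omega)
      rw [add_pow_char_pow, mul_pow, hκi, add_pow_char_pow, one_pow, div_pow,
        pow_sub₀ _ hs0 hle, pow_add s (2 ^ i)]
      ring
    have h3 := congrArg (fun x => s ^ 2 ^ (r + 1) * x) h
    simp only [Finset.mul_sum, mul_one] at h3
    rw [Finset.sum_congr rfl hterm, Finset.sum_add_distrib, Finset.sum_add_distrib,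
      Finset.sum_const, Finset.card_range, nsmul_eq_mul, Finset.sum_range_succ _ (r + 1), ← two_mul,
      ← pow_succ', ← hF, FiniteField.pow_card, ← Finset.mul_sum] at h3
    simp only [G, τ, eval_add, eval_mul, eval_C, eval_X, eval_finsetSum, eval_pow]
    linear_combination h3 + s ^ 2 ^ (r + 1) * h2
  have hcard : Zᶜ.card ≤ 2 ^ r + 2 ^ (r + 1) := by
    refine le_trans ?_ ((Multiset.toFinset_card_le _).trans ((card_roots' G).trans hdeg))
    refine Finset.card_le_card fun s hs => ?_
    rw [Multiset.mem_toFinset, mem_roots hG0]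
    exact hroot s (Finset.mem_compl.1 hs)
  rw [Finset.card_compl, hF] at hcard
  have h4 : 2 ^ (r + 2) = 4 * 2 ^ r := by ring
  have h5 : 2 ^ (r + 1) = 2 * 2 ^ r := by ring
  omega

end Trace

theorem map_fibPolynomial {R S : Type*} [CommRing R] [CommRing S] (f : R →+* S) (j : ℕ) :
    (fibPolynomial R j).map f = fibPolynomial S j := by
  induction j using Nat.twoStepInduction with
  | zero => simp [fibPolynomial]
  | one => simp [fibPolynomial]
  | more j h1 h3 => simp [fibPolynomial, h1, h3]

theorem map_trinomialDifference {R S : Type*} [CommRing R] [CommRing S] (f : R →+* S) (d : ℕ)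
    (s c : R) : (trinomialDifference d s c).map f = trinomialDifference d (f s) (f c) := by
  simp [trinomialDifference, map_fibPolynomial]

theorem natDegree_fibPolynomial_le (R : Type*) [CommRing R] (j : ℕ) :
    (fibPolynomial R j).natDegree ≤ j := by
  rcases j with _ | j
  · simp [fibPolynomial]
  · refine natDegree_le_iff_coeff_eq_zero.2 fun i hi => ?_
    rw [coeff_fibPolynomial_succ, Nat.choose_eq_zero_of_lt (by omega), Nat.cast_zero]

theorem coeff_zero_fibPolynomial (R : Type*) [CommRing R] {j : ℕ} (hj : j ≠ 0) :
    (fibPolynomial R j).coeff 0 = 1 := by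
  obtain ⟨j, rfl⟩ := Nat.exists_eq_succ_of_ne_zero hj
  rw [coeff_fibPolynomial_succ, Nat.choose_zero_right, Nat.cast_one]

theorem fibPolynomial_ne_zero (R : Type*) [CommRing R] [Nontrivial R] {j : ℕ} (hj : j ≠ 0) :
    fibPolynomial R j ≠ 0 := fun h => by
  have := coeff_zero_fibPolynomial R hj
  simp [h] at this

theorem FiniteField.mem_range_of_pow_card_eq {F k : Type*} [Field F] [Fintype F] [Field k]
    (ι : F →+* k) {x : k} (hx : x ^ Fintype.card F = x) : ∃ y, ι y = x := by
  classical
  have h0 : (X ^ Fintype.card F - X : k[X]) ≠ 0 :=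
    FiniteField.X_pow_card_sub_X_ne_zero k Fintype.one_lt_card
  have hsub : Finset.univ.image ι ⊆ (X ^ Fintype.card F - X : k[X]).roots.toFinset := by
    intro z hz
    obtain ⟨y, -, rfl⟩ := Finset.mem_image.1 hz
    rw [Multiset.mem_toFinset, mem_roots h0]
    simp [← map_pow, FiniteField.pow_card]
  have hcard : (X ^ Fintype.card F - X : k[X]).roots.toFinset.card ≤
      (Finset.univ.image ι).card := by
    rw [Finset.card_image_of_injective _ ι.injective, Finset.card_univ]
    refine (Multiset.toFinset_card_le _).trans ((card_roots' _).trans ?_)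
    rw [FiniteField.X_pow_card_sub_X_natDegree_eq k Fintype.one_lt_card]
  have hmem : x ∈ (X ^ Fintype.card F - X : k[X]).roots.toFinset := by
    rw [Multiset.mem_toFinset, mem_roots h0]
    simp [hx]
  rw [← Finset.eq_of_subset_of_card_le hsub hcard] at hmem
  obtain ⟨y, -, hy⟩ := Finset.mem_image.1 hmem
  exact ⟨y, hy⟩

theorem card_eval_sq_add_self_eq {F k : Type*} [Field F] [Fintype F] [Field k] [IsAlgClosed k]
    [CharP k 2] (ι : F →+* k) {H : k[X]} (hH : H.natDegree ≠ 0) {t : k}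
    (hroots : ∀ u, H.eval (u ^ 2 + u) = t → u ^ Fintype.card F = u)
    (hcrit : ∀ y, (derivative H).eval y = 0 → H.eval y ≠ t) :
    Nat.card {u : F | H.eval (ι (u ^ 2 + u)) = t} = 2 * H.natDegree := by
  classical
  have h2 : (2 : k) = 0 := CharTwo.two_eq_zero
  set p : k[X] := H.comp (X ^ 2 + X) - C t with hp
  have hdeg : p.natDegree = 2 * H.natDegree := by
    rw [hp, natDegree_sub_C, natDegree_comp, natDegree_X_sq_add_X, mul_comm]
  have hp0 : p ≠ 0 := fun h => by
    rw [h, natDegree_zero] at hdeg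
    omega
  have heval : ∀ u, p.eval u = H.eval (u ^ 2 + u) - t := fun u => by simp [hp, eval_comp]
  have hnodup : p.roots.Nodup := by
    rw [Multiset.nodup_iff_count_le_one]
    intro u
    rw [count_roots]
    by_contra hlt
    have h := (one_lt_rootMultiplicity_iff_isRoot hp0).1 (not_le.1 hlt)
    have hu : H.eval (u ^ 2 + u) = t := sub_eq_zero.1 ((heval u).symm.trans h.1)
    refine hcrit _ ?_ hu
    have h3 := h.2
    simpa [hp, derivative_comp, eval_comp, derivative_pow, h2] using h3
  have himage : ι '' {u : F | H.eval (ι (u ^ 2 + u)) = t} = p.roots.toFinset := by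
    ext u
    rw [Finset.mem_coe, Multiset.mem_toFinset, mem_roots hp0, IsRoot, heval, sub_eq_zero]
    constructor
    · rintro ⟨v, hv, rfl⟩
      simpa using hv
    · intro hu
      obtain ⟨v, rfl⟩ := FiniteField.mem_range_of_pow_card_eq ι (hroots u hu)
      exact ⟨v, by simpa using hu, rfl⟩
  rw [Nat.card_coe_set_eq, ← Set.ncard_image_of_injective _ ι.injective, himage,
    Set.ncard_coe_finset, Multiset.toFinset_card_of_nodup hnodup, ← hdeg,
    (IsAlgClosed.splits p).natDegree_eq_card_roots]

/-- The trinomial statement after normalising the leading coefficients and the shift. -/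
theorem exists_card_trinomial_difference_eq {k : Type*} [Field k] [IsAlgClosed k] [CharP k 2]
    (e : ℕ) (he : e ≠ 0)
    (hM : ∀ ζ₁ ζ₂ : k, ζ₁ ≠ 1 → ζ₂ ≠ 1 → ζ₁ ^ (2 * (2 * e + 1)) = 1 → ζ₂ ^ (2 * (2 * e + 1)) = 1 →
      ((1 + ζ₁) / (1 + ζ₂)) ^ (2 * (2 * e + 1)) = 1 → ζ₁ = ζ₂ ∨ ζ₁ = ζ₂⁻¹) :
    ∃ N : ℕ, ∀ n ≥ N, ∀ (F : Type) [Field F] [Fintype F] [CharP F 2], Fintype.card F = 2 ^ n →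
      ∀ (_ : F →+* k) (c : F), ∃ s ≠ 0, ∃ t : F,
        Nat.card {u : F | u ^ (2 * (2 * e + 1) + 1) + (u + 1) ^ (2 * (2 * e + 1) + 1) +
          s * (u ^ (2 * (2 * e + 1) + 2) + (u + 1) ^ (2 * (2 * e + 1) + 2)) +
          c / s * (u ^ (2 * (2 * e + 1)) + (u + 1) ^ (2 * (2 * e + 1))) = t} =
        2 * (2 * e + 1) := by
  classical
  set d := 2 * e + 1 with hd
  have key : ((d : ℕ) : k) = 1 := by
    rw [← Nat.cast_one, CharP.cast_eq_iff_mod_eq k 2]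
    omega
  obtain ⟨n₀, hn₀⟩ := exists_forall_eval_sq_add_self_eq (k := k) d (2 * d)
    (by rw [key]; exact one_ne_zero) (by omega)
  refine ⟨max n₀ (2 * d + 5), fun n hn F _ _ _ hF ι c => ?_⟩
  have hfib0 : fibPolynomial F (2 * d) ≠ 0 := fibPolynomial_ne_zero F (by omega)
  let Z : Finset F := {0, 1} ∪ (fibPolynomial F (2 * d)).roots.toFinset.image fun y => c / y
  have hZ : Z.card < 2 ^ (n - 2) := by
    have h1 : Z.card ≤ 2 + 2 * d := (Finset.card_union_le _ _).trans (add_le_add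
      Finset.card_le_two (Finset.card_image_le.trans ((Multiset.toFinset_card_le _).trans
        ((card_roots' _).trans (natDegree_fibPolynomial_le F _)))))
    have h2 : n - 2 < 2 ^ (n - 2) := Nat.lt_two_pow_self
    omega
  obtain ⟨s, hs, w, hw⟩ := exists_notMem_sq_add_self_eq (n := n) (by omega) hF
    (κ := ((e + 1 : ℕ) : F)) (by
      rcases Nat.mod_two_eq_zero_or_one (e + 1) with h | h
      · left
        rw [← Nat.cast_zero, CharP.cast_eq_iff_mod_eq F 2, h]
      · right
        exact ((CharP.cast_eq_iff_mod_eq F 2).2 h).trans Nat.cast_one) c Z hZ (by simp [Z])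
  have hs0 : s ≠ 0 := by
    rintro rfl
    simp [Z] at hs
  have hs1 : s ≠ 1 := by
    rintro rfl
    simp [Z] at hs
  have hc : (fibPolynomial F (2 * d)).eval (c / s) ≠ 0 := by
    intro h
    have hcs : c / s ≠ 0 := by
      intro h0
      rw [h0, ← coeff_zero_eq_eval_zero, coeff_zero_fibPolynomial F (by omega)] at h
      exact one_ne_zero h
    refine hs (Finset.mem_union_right _ (Finset.mem_image.2 ⟨c / s, ?_, ?_⟩))
    · rwa [Multiset.mem_toFinset, mem_roots hfib0]
    · have hc0 : c ≠ 0 := fun h0 => hcs (by simp [h0])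
      field_simp
  have hfix : ∀ x : F, ι x ^ 2 ^ n = ι x := fun x => by
    rw [← map_pow, ← hF, FiniteField.pow_card]
  set H : k[X] := trinomialDifference d (ι s) (ι (c / s)) with hH
  have hdegH : H.natDegree = d := natDegree_trinomialDifference ⟨e, by ring⟩ _ _
  have hder : derivative H = fibPolynomial k (2 * d) := derivative_trinomialDifference d _ _
  have hder0 : derivative H ≠ 0 := hder ▸ fibPolynomial_ne_zero k (by omega)
  have hmorse : IsMorse H := by
    refine isMorse_trinomialDifference (fun h => hs1 (ι.injective (h.trans ι.map_one.symm))) ?_ hM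
    rw [← map_fibPolynomial ι, eval_map, eval₂_at_apply]
    exact fun h => hc (ι.injective (h.trans ι.map_zero.symm))
  let A : Finset k := Finset.univ.image ι \ (derivative H).roots.toFinset.image H.eval
  have hA : 2 ^ n ≤ A.card + 2 * d := by
    have h1 : (Finset.univ.image ι).card = 2 ^ n := by
      rw [Finset.card_image_of_injective _ ι.injective, Finset.card_univ, hF]
    have h2 : ((derivative H).roots.toFinset.image H.eval).card ≤ 2 * d :=
      Finset.card_image_le.trans ((Multiset.toFinset_card_le _).trans ((card_roots' _).trans
        (hder ▸ natDegree_fibPolynomial_le k _)))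
    have h3 := Finset.le_card_sdiff ((derivative H).roots.toFinset.image H.eval)
      (Finset.univ.image ι)
    have h4 : A.card = (Finset.univ.image ι \ (derivative H).roots.toFinset.image H.eval).card :=
      rfl
    omega
  have hAcrit : ∀ t ∈ A, ∀ y, (derivative H).eval y = 0 → H.eval y ≠ t := by
    rintro t ht y hy rfl
    refine (Finset.mem_sdiff.1 ht).2 (Finset.mem_image_of_mem _ ?_)
    rwa [Multiset.mem_toFinset, mem_roots hder0]
  obtain ⟨t, htA, ht⟩ := hn₀ n (le_of_max_le_left hn) H
    (monic_trinomialDifference ⟨e, by ring⟩ _ _) hdegH hmorse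
    (fun i => by rw [hH, ← map_trinomialDifference, coeff_map, hfix]) (ι w) (hfix w)
    (by rw [hH, nextCoeff_trinomialDifference, ← map_pow, ← map_add, hw]; simp) A hA
    (fun t ht => by
      obtain ⟨x, -, rfl⟩ := Finset.mem_image.1 (Finset.mem_sdiff.1 ht).1
      exact hfix x) hAcrit
  obtain ⟨t, -, rfl⟩ := Finset.mem_image.1 (Finset.mem_sdiff.1 htA).1
  refine ⟨s, hs0, t, ?_⟩
  refine Eq.trans ?_ ((card_eval_sq_add_self_eq ι (by omega) (fun u hu => hF ▸ ht u hu)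
    (hAcrit _ htA)).trans (congrArg _ hdegH))
  refine congrArg (fun S : Set F => Nat.card S) (Set.ext fun u => ?_)
  rw [Set.mem_ofPred_eq, Set.mem_ofPred_eq]
  have h := aeval_trinomialDifference d (ι s) (ι (c / s)) (ι u)
  rw [coe_aeval_eq_eval, Algebra.algebraMap_self, RingHom.id_apply, RingHom.id_apply] at h
  rw [map_add, map_pow, h, ← ι.injective.eq_iff]
  simp

/-- Let `m ≥ 8` with `m ≡ 0 (mod 4)` and `m - 1 ∈ 𝓜`.  Then for `n` sufficiently large
(depending only on `m`) and every trinomial `f = a₀ x^m + a₁ x^(m-1) + a₂ x^(m-2)` over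
`𝔽_{2^n}` of degree `m` with `a₁ ≠ 0`, there exist `α ∈ 𝔽_{2^n} \ {0}` and `β ∈ 𝔽_{2^n}`
such that `f(x+α) - f(x) = β` has exactly `m - 2` distinct solutions `x ∈ 𝔽_{2^n}`. -/
theorem trinomial_exists_beta_with_max_solutions (m : ℕ) (hm : 8 ≤ m) (hm4 : m % 4 = 0)
    (hM : InM (m - 1)) :
    ∃ N : ℕ, ∀ n : ℕ, N ≤ n → ∀ a₀ a₁ a₂ : GaloisField 2 n, a₀ ≠ 0 → a₁ ≠ 0 →
      ∃ α : GaloisField 2 n, α ≠ 0 ∧ ∃ β : GaloisField 2 n,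
        Nat.card {x : GaloisField 2 n |
          (C a₀ * X ^ m + C a₁ * X ^ (m - 1) + C a₂ * X ^ (m - 2)).eval (x + α) -
            (C a₀ * X ^ m + C a₁ * X ^ (m - 1) + C a₂ * X ^ (m - 2)).eval x = β} = m - 2 := by
  replace hM := hM.2.2
  obtain ⟨e, rfl⟩ : ∃ e, m = 2 * (2 * e + 1) + 2 := ⟨m / 4 - 1, by omega⟩
  rw [show 2 * (2 * e + 1) + 2 - 1 - 1 = 2 * (2 * e + 1) by omega] at hM
  obtain ⟨N, hN⟩ := exists_card_trinomial_difference_eq e (by omega) hM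
  refine ⟨max N 1, fun n hn a₀ a₁ a₂ h₀ h₁ => ?_⟩
  have : Fintype (GaloisField 2 n) := Fintype.ofFinite _
  have : CharP (GaloisField 2 n) 2 := inferInstance
  have h2 : (2 : GaloisField 2 n) = 0 := CharTwo.two_eq_zero
  have hF : Fintype.card (GaloisField 2 n) = 2 ^ n := by
    rw [← Nat.card_eq_fintype_card, GaloisField.card 2 n (by omega)]
  let ι : GaloisField 2 n →ₐ[ZMod 2] AlgebraicClosure (ZMod 2) := IsAlgClosed.lift
  obtain ⟨s, hs0, t, ht⟩ := hN n (le_of_max_le_left hn) (GaloisField 2 n) hF ι.toRingHom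
    (a₀ * a₂ / a₁ ^ 2)
  set d := 2 * e + 1
  have hα : s * a₁ / a₀ ≠ 0 := div_ne_zero (mul_ne_zero hs0 h₁) h₀
  set α := s * a₁ / a₀ with hαdef
  have hγ : a₁ * α ^ (2 * d + 1) ≠ 0 := mul_ne_zero h₁ (pow_ne_zero _ hα)
  refine ⟨α, hα, a₁ * α ^ (2 * d + 1) * t, ?_⟩
  rw [Nat.add_sub_cancel, show 2 * d + 2 - 1 = 2 * d + 1 by omega]
  refine Eq.trans ?_ ht
  refine (Nat.card_congr ((Equiv.mulLeft₀ α hα).subtypeEquiv fun u => ?_)).symm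
  simp only [Set.mem_ofPred_eq, Equiv.mulLeft₀_apply, eval_add, eval_mul, eval_C, eval_pow, eval_X]
  rw [← mul_right_inj' hγ]
  have e₀ : a₁ * α ^ (2 * d + 1) * s = a₀ * α ^ (2 * d + 2) := by
    rw [pow_succ α (2 * d + 1), hαdef]
    field_simp
  have e₂ : a₁ * α ^ (2 * d + 1) * (a₀ * a₂ / a₁ ^ 2 / s) = a₂ * α ^ (2 * d) := by
    rw [pow_succ α (2 * d)]
    nth_rewrite 2 [hαdef]
    field_simp
  have h : ∀ j, (α * u + α) ^ j = α ^ j * (u + 1) ^ j := fun j => by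
    rw [← mul_pow, mul_add, mul_one]
  rw [h, h, h, mul_add, mul_add, ← mul_assoc, ← mul_assoc, e₀, e₂, mul_pow, mul_pow, mul_pow]
  refine Eq.congr ?_ rfl
  linear_combination (a₁ * α ^ (2 * d + 1) * u ^ (2 * d + 1) +
    a₀ * α ^ (2 * d + 2) * u ^ (2 * d + 2) + a₂ * α ^ (2 * d) * u ^ (2 * d)) * h2
end

section
/- The integer 7 belongs to the set 𝓜; that is, for all ζ₁, ζ₂ in the algebraic closure of 𝔽₂ with ζ₁ ≠ 1 and ζ₂ ≠ 1, if ζ₁⁶ = ζ₂⁶ = ((1+ζ₁)/(1+ζ₂))⁶ = 1 then ζ₁ = ζ₂ or ζ₁ = ζ₂^{−1}. Consequently, the main theorem applies to degree m = 8. -/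
/-- In characteristic two, a sixth root of unity other than `1` is a primitive cube root of
unity. -/
theorem CharTwo.sq_add_self_add_one_eq_zero {K : Type*} [Field K] [CharP K 2] {z : K}
    (hz : z ≠ 1) (h : z ^ 6 = 1) : z ^ 2 + z + 1 = 0 := by
  have h2 : (2 : K) = 0 := CharTwo.two_eq_zero
  have h3 : (z ^ 3 - 1) ^ 2 = 0 := by linear_combination h + (1 - z ^ 3) * h2
  have h4 : (z - 1) * (z ^ 2 + z + 1) = 0 := by
    linear_combination pow_eq_zero_iff two_ne_zero |>.mp h3
  exact (mul_eq_zero.mp h4).resolve_left (sub_ne_zero.mpr hz)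

/-- The integer `7` belongs to `𝓜`: for all `ζ₁, ζ₂` in the algebraic closure of `𝔽₂` with
`ζ₁ ≠ 1` and `ζ₂ ≠ 1`, if `ζ₁⁶ = ζ₂⁶ = ((1+ζ₁)/(1+ζ₂))⁶ = 1` then `ζ₁ = ζ₂` or `ζ₁ = ζ₂⁻¹`. -/
theorem seven_mem_M : InM 7 := by
  refine ⟨by decide, by norm_num, fun z w hz hw hz6 hw6 _ => ?_⟩
  have : CharP (AlgebraicClosure (ZMod 2)) 2 := charP_of_injective_algebraMap' (ZMod 2) 2
  have hz' := CharTwo.sq_add_self_add_one_eq_zero hz hz6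
  have hw' := CharTwo.sq_add_self_add_one_eq_zero hw hw6
  have h : (z - w) * (z + w + 1) = 0 := by linear_combination hz' - hw'
  rcases mul_eq_zero.mp h with h | h
  · exact Or.inl (sub_eq_zero.mp h)
  · exact Or.inr (eq_inv_of_mul_eq_one_left (by linear_combination w * h - hw'))
end

section
/- For every integer k ≥ 2, the integer 2^k + 3 belongs to the set 𝓜 (equivalently, the degrees m = 2^k + 4 with k ≥ 2 satisfy m ≡ 0 (mod 4) and m−1 ∈ 𝓜, so the main theorem applies to them). -/
/-- In characteristic two, `(1 + x) ^ (2 ^ k + 2) * x ^ 2 = (1 + x) ^ 4` whenever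
`x ^ (2 ^ k + 2) = 1`. -/
theorem one_add_pow_two_pow_add_two_mul_sq {R : Type*} [CommRing R] [CharP R 2] {k : ℕ} {x : R}
    (hx : x ^ (2 ^ k + 2) = 1) : (1 + x) ^ (2 ^ k + 2) * x ^ 2 = (1 + x) ^ 4 := by
  have h : (1 + x) ^ 2 = 1 + x ^ 2 := by rw [add_pow_char, one_pow]
  rw [pow_add] at hx ⊢
  rw [add_pow_char_pow, one_pow]
  linear_combination (1 + x) ^ 2 * (hx - h)

/-- For every integer `k ≥ 2`, the integer `2 ^ k + 3` belongs to `𝓜`. -/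
theorem pow_two_add_three_mem_M : ∀ k : ℕ, 2 ≤ k → InM (2 ^ k + 3) := by
  intro k hk
  have hodd : Odd (2 ^ k + 3) :=
    (Nat.even_pow.2 ⟨even_two, by omega⟩).add_odd (by decide)
  refine ⟨hodd, Nat.succ_pos _, fun a b _ hb1 ha hb hab => ?_⟩
  rw [show 2 ^ k + 3 - 1 = 2 ^ k + 2 from rfl] at ha hb hab
  have : CharP (AlgebraicClosure (ZMod 2)) 2 := charP_of_injective_algebraMap' (ZMod 2) 2
  have hb1' : 1 + b ≠ 0 := fun h => hb1 (CharTwo.add_eq_zero.1 h).symm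
  rw [div_pow, div_eq_one_iff_eq (pow_ne_zero _ hb1')] at hab
  have hsq : ((a - b) * (a * b - 1)) ^ 2 = 0 := by
    have h : ((1 + a) ^ 2 * b) ^ 2 = ((1 + b) ^ 2 * a) ^ 2 := by
      linear_combination a ^ 2 * one_add_pow_two_pow_add_two_mul_sq hb
        - b ^ 2 * one_add_pow_two_pow_add_two_mul_sq ha + a ^ 2 * b ^ 2 * hab
    have h' : ((1 + a) ^ 2 * b - (1 + b) ^ 2 * a) ^ 2 = 0 := by
      rw [sub_pow_char, h, sub_self]
    rw [← h']
    ring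
  rcases mul_eq_zero.1 (pow_eq_zero_iff two_ne_zero |>.1 hsq) with h | h
  · exact Or.inl (sub_eq_zero.1 h)
  · exact Or.inr (eq_inv_of_mul_eq_one_left (sub_eq_zero.1 h))
end
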